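/- arXiv:1112.1548 — 4 statements merged into one kernel-verified Lean document; each statement's English description precedes it below -/
import Mathlib

section
/- For all sufficiently large natural numbers n, every 2-coloring of the edges of the complete graph on the vertex set {2, 3, ..., n} contains a monochromatic clique with vertex set S such that ∑_{s ∈ S} 1/log₂ s ≥ 2^{-8} · log₂ log₂ log₂ n. -/
/-- `S` is a clique of colour `a` in the colouring `c`, where the edge `{i, j}` with `i < j`
has colour `c i j`. -/
def IsMonoClique (c : ℕ → ℕ → Fin 2) (a : Fin 2) (S : Finset ℕ) : Prop :=
  ∀ i ∈ S, ∀ j ∈ S, i < j → c i j = a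

lemma IsMonoClique.insert_of_lt {c : ℕ → ℕ → Fin 2} {a : Fin 2} {S : Finset ℕ} {v : ℕ}
    (hS : IsMonoClique c a S) (hv : ∀ w ∈ S, v < w ∧ c v w = a) :
    IsMonoClique c a (insert v S) := by
  intro i hi j hj hij
  rw [Finset.mem_insert] at hi hj
  rcases hi with rfl | hi <;> rcases hj with rfl | hj
  · exact absurd hij (lt_irrefl _)
  · exact (hv j hj).2
  · exact absurd hij (hv i hi).1.asymm
  · exact hS i hi j hj hij

lemma exp_two_sqrt_sub_mul_le {r x y : ℝ} (hr : 0 < r) (hrx : r ≤ x) (hy : 0 < y) :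
    Real.exp (2 * √((x - r) * y)) ≤ Real.exp (2 * √(x * y)) / (1 + r * y / √(x * y)) := by
  have hx : 0 < x := hr.trans_le hrx
  have hxy : 0 < x * y := mul_pos hx hy
  set w := √(x * y) with hw
  have hw0 : 0 < w := Real.sqrt_pos.2 hxy
  have hw2 : w * w = x * y := Real.mul_self_sqrt hxy.le
  set u := r * y / w with hu
  have hu0 : 0 < u := by positivity
  have huw : u * w = r * y := by rw [hu]; field_simp
  have huw' : u ≤ w := by
    have : u * w ≤ w * w := by rw [huw, hw2]; gcongr
    exact le_of_mul_le_mul_right this hw0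
  have hs : √((x - r) * y) ≤ w - u / 2 := by
    apply Real.sqrt_le_iff.2
    constructor
    · linarith
    · nlinarith [sq_nonneg u]
  have he : 1 + u ≤ Real.exp u := by linarith [Real.add_one_le_exp u]
  rw [le_div_iff₀ (by positivity)]
  calc Real.exp (2 * √((x - r) * y)) * (1 + u)
      ≤ Real.exp (2 * (w - u / 2)) * Real.exp u := by gcongr
    _ = Real.exp (2 * w) := by rw [← Real.exp_add]; ring_nf

lemma exp_two_sqrt_add_le {r b x y : ℝ} (hr : 0 < r) (hb : 0 < b) (hrb : 1 ≤ r * b)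
    (hrx : r ≤ x) (hby : b ≤ y) :
    Real.exp (2 * √((x - r) * y)) + Real.exp (2 * √(x * (y - b))) ≤
      Real.exp (2 * √(x * y)) := by
  have hx : 0 < x := hr.trans_le hrx
  have hy : 0 < y := hb.trans_le hby
  have hxy : 0 < x * y := mul_pos hx hy
  have h1 := exp_two_sqrt_sub_mul_le hr hrx hy
  have h2 := exp_two_sqrt_sub_mul_le hb hby hx
  rw [mul_comm (y - b), mul_comm y x] at h2
  set w := √(x * y) with hw
  have hw0 : 0 < w := Real.sqrt_pos.2 hxy
  have hw2 : w * w = x * y := Real.mul_self_sqrt hxy.le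
  set u := r * y / w with hu
  set v := b * x / w with hv
  have hu0 : 0 < u := by positivity
  have hv0 : 0 < v := by positivity
  have huv : 1 ≤ u * v := by
    have : u * v = r * b := by
      rw [hu, hv, div_mul_div_comm, hw2]; field_simp
    rwa [this]
  have h3 : 1 / (1 + u) + 1 / (1 + v) ≤ 1 := by
    rw [div_add_div _ _ (by positivity) (by positivity), div_le_one (by positivity)]
    nlinarith
  calc _ ≤ Real.exp (2 * w) / (1 + u) + Real.exp (2 * w) / (1 + v) := add_le_add h1 h2
    _ = Real.exp (2 * w) * (1 / (1 + u) + 1 / (1 + v)) := by ring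
    _ ≤ Real.exp (2 * w) * 1 := by gcongr
    _ = _ := mul_one _

/-- A weighted form of the Erdős–Szekeres bound: every vertex carries a weight for each of the
two colours, and the product of its weights is at least one. -/
theorem card_add_one_le_exp_of_isMonoClique_weight_le (c : ℕ → ℕ → Fin 2) (r b : ℕ → ℝ)
    (V : Finset ℕ) (hV : ∀ v ∈ V, 0 < r v ∧ 0 < b v ∧ 1 ≤ r v * b v) (x y : ℝ)
    (hx : ∀ S ⊆ V, IsMonoClique c 0 S → ∑ s ∈ S, r s ≤ x)
    (hy : ∀ S ⊆ V, IsMonoClique c 1 S → ∑ s ∈ S, b s ≤ y) :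
    (V.card : ℝ) + 1 ≤ Real.exp (2 * √(x * y)) := by
  induction V using Finset.strongInduction generalizing x y with
  | H V ih =>
  rcases V.eq_empty_or_nonempty with rfl | hne
  · simp
  set v := V.min' hne with hv
  have hvV : v ∈ V := V.min'_mem hne
  obtain ⟨hr, hb, hrb⟩ := hV v hvV
  have hlt : ∀ w ∈ V.erase v, v < w := fun w hw ↦ V.min'_lt_of_mem_erase_min' hne hw
  have hsingle (a : Fin 2) : IsMonoClique c a {v} := by
    intro i hi j hj hij
    simp only [Finset.mem_singleton] at hi hj
    omega
  have hrx : r v ≤ x := by simpa using hx {v} (by simpa using hvV) (hsingle 0)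
  have hby : b v ≤ y := by simpa using hy {v} (by simpa using hvV) (hsingle 1)
  let N : Fin 2 → Finset ℕ := fun a ↦ (V.erase v).filter fun w ↦ c v w = a
  have hNe (a : Fin 2) : N a ⊆ V.erase v := Finset.filter_subset _ _
  have hN (a : Fin 2) : N a ⊂ V := (hNe a).trans_ssubset (Finset.erase_ssubset hvV)
  have hNV (a : Fin 2) : ∀ w ∈ N a, 0 < r w ∧ 0 < b w ∧ 1 ≤ r w * b w :=
    fun w hw ↦ hV w ((hN a).1 hw)
  have hins (a : Fin 2) (S : Finset ℕ) (hS : S ⊆ N a) (hc : IsMonoClique c a S) :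
      v ∉ S ∧ insert v S ⊆ V ∧ IsMonoClique c a (insert v S) :=
    ⟨fun h ↦ by simpa using hNe a (hS h), Finset.insert_subset hvV (hS.trans (hN a).1),
      hc.insert_of_lt fun w hw ↦ ⟨hlt w (hNe a (hS hw)), (Finset.mem_filter.1 (hS hw)).2⟩⟩
  have h0 := ih (N 0) (hN 0) (hNV 0) (x - r v) y
    (fun S hS hc ↦ by
      obtain ⟨h1, h2, h3⟩ := hins 0 S hS hc
      have := hx _ h2 h3
      rw [Finset.sum_insert h1] at this
      linarith)
    (fun S hS hc ↦ hy S (hS.trans (hN 0).1) hc)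
  have h1 := ih (N 1) (hN 1) (hNV 1) x (y - b v)
    (fun S hS hc ↦ hx S (hS.trans (hN 1).1) hc)
    (fun S hS hc ↦ by
      obtain ⟨h1, h2, h3⟩ := hins 1 S hS hc
      have := hy _ h2 h3
      rw [Finset.sum_insert h1] at this
      linarith)
  have hcard : V.card = (N 0).card + (N 1).card + 1 := by
    have h2 : (N 0).card + (N 1).card = (V.erase v).card := by
      rw [← Finset.card_filter_add_card_filter_not (s := V.erase v) (fun w ↦ c v w = 0)]
      congr 2
      ext w
      simp only [N, Finset.mem_filter]
      have : c v w = 1 ↔ ¬ c v w = 0 := by omega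
      rw [this]
    have := Finset.card_erase_add_one hvV
    omega
  have := exp_two_sqrt_add_le hr hb hrb hrx hby
  rw [hcard]
  push_cast
  linarith

lemma exists_isMonoClique_card_mul_card (c : ℕ → ℕ → Fin 2) (A : Finset ℕ) (M e : ℕ)
    (hA : 2 ^ e ≤ A.card) (he : M ≤ 4 * e) :
    ∃ P ⊆ A, ∃ Q ⊆ A, IsMonoClique c 0 P ∧ IsMonoClique c 1 Q ∧
      M ^ 2 ≤ 256 * (P.card * Q.card) := by
  classical
  have hmax (a : Fin 2) : ∃ P ⊆ A, IsMonoClique c a P ∧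
      ∀ S ⊆ A, IsMonoClique c a S → S.card ≤ P.card := by
    obtain ⟨P, hP, hmax⟩ := (A.powerset.filter (IsMonoClique c a)).exists_max_image Finset.card
      ⟨∅, by simp [IsMonoClique]⟩
    simp only [Finset.mem_filter, Finset.mem_powerset] at hP hmax
    exact ⟨P, hP.1, hP.2, fun S h1 h2 ↦ hmax S ⟨h1, h2⟩⟩
  obtain ⟨P, hPA, hP, hPmax⟩ := hmax 0
  obtain ⟨Q, hQA, hQ, hQmax⟩ := hmax 1
  refine ⟨P, hPA, Q, hQA, hP, hQ, ?_⟩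
  have h := card_add_one_le_exp_of_isMonoClique_weight_le c (fun _ ↦ 1) (fun _ ↦ 1) A
    (by simp) P.card Q.card (by simpa using hPmax) (by simpa using hQmax)
  set w := √((P.card : ℝ) * Q.card) with hw
  have hw2 : w ^ 2 = (P.card : ℝ) * Q.card := Real.sq_sqrt (by positivity)
  have h1 : (2 : ℝ) ^ e ≤ Real.exp (2 * w) := by
    have : (2 : ℝ) ^ e ≤ A.card := by exact_mod_cast hA
    linarith
  have h2 : (e : ℝ) * Real.log 2 ≤ 2 * w := by
    have := Real.log_le_log (by positivity) h1
    rwa [Real.log_exp, Real.log_pow] at this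
  have h3 : (M : ℝ) ≤ 4 * e := by exact_mod_cast he
  have h4 : (M : ℝ) ≤ 16 * w := by
    have := Real.log_two_gt_d9
    nlinarith [(Nat.cast_nonneg e : (0 : ℝ) ≤ e)]
  have h5 : (M : ℝ) ^ 2 ≤ 256 * ((P.card : ℝ) * Q.card) := by
    rw [← hw2]
    calc (M : ℝ) ^ 2 ≤ (16 * w) ^ 2 := by gcongr
      _ = _ := by ring
  exact_mod_cast h5

/-- Dependent random choice. -/
lemma exists_subset_card_commonNeighbors (c : ℕ → ℕ → Fin 2) (A B : Finset ℕ)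
    (hA : A.Nonempty) (hB : B.Nonempty) (m k X : ℕ)
    (h : A.card ^ m * 2 ^ (k + 1) ≤ 2 ^ (X * k)) :
    ∃ a : Fin 2, ∃ A' ⊆ A, A.card ≤ A'.card * 2 ^ (k + 2) ∧
      ∀ S ⊆ A', S.card ≤ m →
        B.card ≤ (B.filter fun y ↦ ∀ s ∈ S, c s y = a).card * 2 ^ X := by
  classical
  obtain ⟨a, A₀, hA₀A, hA₀, hdeg⟩ : ∃ a : Fin 2, ∃ A₀ ⊆ A, A.card ≤ 2 * A₀.card ∧
      ∀ v ∈ A₀, B.card ≤ 2 * (B.filter fun y ↦ c v y = a).card := by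
    let p : ℕ → Prop := fun v ↦ B.card ≤ 2 * (B.filter fun y ↦ c v y = 0).card
    have hsplit := Finset.card_filter_add_card_filter_not (s := A) p
    rcases le_total (A.filter fun v ↦ ¬ p v).card (A.filter p).card with hle | hle
    · exact ⟨0, A.filter p, Finset.filter_subset _ _, by omega,
        fun v hv ↦ (Finset.mem_filter.1 hv).2⟩
    · refine ⟨1, A.filter fun v ↦ ¬ p v, Finset.filter_subset _ _, by omega, fun v hv ↦ ?_⟩
      have h1 := (Finset.mem_filter.1 hv).2
      have h2 := Finset.card_filter_add_card_filter_not (s := B) (fun y ↦ c v y = 0)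
      have h3 : (B.filter fun y ↦ c v y = 1) = B.filter fun y ↦ ¬ c v y = 0 := by
        ext w
        have : c v w = 1 ↔ ¬ c v w = 0 := by omega
        simp only [Finset.mem_filter, this]
      simp only [p] at h1
      rw [h3]
      omega
  have hA₀pos : 0 < A₀.card := by have := hA.card_pos; omega
  let Y : Finset (Fin k → ℕ) := Fintype.piFinset fun _ ↦ B
  have hYcard : Y.card = B.card ^ k := by simp [Y]
  have hYne : Y.Nonempty := by
    rw [← Finset.card_pos, hYcard]; exact pow_pos hB.card_pos k
  let U : (Fin k → ℕ) → Finset ℕ := fun y ↦ A₀.filter fun v ↦ ∀ l, c v (y l) = a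
  let N : (Fin m → ℕ) → Finset ℕ := fun f ↦ B.filter fun y ↦ ∀ t, c (f t) y = a
  let bad : Finset (Fin m → ℕ) :=
    (Fintype.piFinset fun _ ↦ A).filter fun f ↦ (N f).card * 2 ^ X < B.card
  let Z : (Fin k → ℕ) → Finset (Fin m → ℕ) := fun y ↦ bad.filter fun f ↦ ∀ t, f t ∈ U y
  have hsumU : A₀.card * B.card ^ k ≤ 2 ^ k * ∑ y ∈ Y, (U y).card := by
    have h1 : ∑ y ∈ Y, (U y).card =
        ∑ v ∈ A₀, (B.filter fun y ↦ c v y = a).card ^ k := by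
      refine (Finset.sum_card_bipartiteAbove_eq_sum_card_bipartiteBelow
        (s := Y) (t := A₀) fun y v ↦ ∀ l, c v (y l) = a).trans ?_
      refine Finset.sum_congr rfl fun v _ ↦ ?_
      have : (Finset.bipartiteBelow (fun y v ↦ ∀ l, c v (y l) = a) Y v) =
          Fintype.piFinset fun _ : Fin k ↦ B.filter fun y ↦ c v y = a := by
        ext y
        simp [Finset.bipartiteBelow, Y, forall_and]
      rw [this]; simp
    rw [h1, Finset.mul_sum, ← smul_eq_mul, ← Finset.sum_const]
    refine Finset.sum_le_sum fun v hv ↦ ?_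
    rw [← mul_pow]
    exact Nat.pow_le_pow_left (hdeg v hv) k
  have hsumZ : 2 ^ (k + 1) * ∑ y ∈ Y, (Z y).card ≤ B.card ^ k := by
    have h1 : ∑ y ∈ Y, (Z y).card ≤ ∑ f ∈ bad, (N f).card ^ k := by
      refine (Finset.sum_card_bipartiteAbove_eq_sum_card_bipartiteBelow
        (s := Y) (t := bad) fun y f ↦ ∀ t, f t ∈ U y).trans_le ?_
      refine Finset.sum_le_sum fun f _ ↦ ?_
      have : (Finset.bipartiteBelow (fun y f ↦ ∀ t, f t ∈ U y) Y f) ⊆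
          Fintype.piFinset fun _ : Fin k ↦ N f := by
        intro y hy
        simp only [Finset.bipartiteBelow, Finset.mem_filter, Y, U, N,
          Fintype.mem_piFinset] at hy ⊢
        exact fun l ↦ ⟨hy.1 l, fun t ↦ (hy.2 t).2 l⟩
      simpa using Finset.card_le_card this
    have h2 : (∑ f ∈ bad, (N f).card ^ k) * 2 ^ (X * k) ≤ A.card ^ m * B.card ^ k := by
      rw [Finset.sum_mul]
      calc ∑ f ∈ bad, (N f).card ^ k * 2 ^ (X * k)
          ≤ ∑ f ∈ bad, B.card ^ k := by
            refine Finset.sum_le_sum fun f hf ↦ ?_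
            rw [pow_mul, ← mul_pow]
            exact Nat.pow_le_pow_left (Finset.mem_filter.1 hf).2.le k
        _ = bad.card * B.card ^ k := by simp
        _ ≤ A.card ^ m * B.card ^ k := by
            gcongr
            simpa using Finset.card_filter_le
              (Fintype.piFinset fun _ : Fin m ↦ A) fun f ↦ (N f).card * 2 ^ X < B.card
    refine le_of_mul_le_mul_left (a := 2 ^ (X * k)) ?_ (by positivity)
    calc 2 ^ (X * k) * (2 ^ (k + 1) * ∑ y ∈ Y, (Z y).card)
        ≤ 2 ^ (X * k) * (2 ^ (k + 1) * ∑ f ∈ bad, (N f).card ^ k) := by gcongr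
      _ = 2 ^ (k + 1) * ((∑ f ∈ bad, (N f).card ^ k) * 2 ^ (X * k)) := by ring
      _ ≤ 2 ^ (k + 1) * (A.card ^ m * B.card ^ k) := by gcongr
      _ = (A.card ^ m * 2 ^ (k + 1)) * B.card ^ k := by ring
      _ ≤ 2 ^ (X * k) * B.card ^ k := by gcongr
  obtain ⟨y, hy, hyU, hyZ⟩ : ∃ y ∈ Y, A₀.card ≤ (U y).card * 2 ^ (k + 1) ∧ Z y = ∅ := by
    by_contra! hcon
    have hlt : ∑ y ∈ Y, (U y).card * 2 ^ (k + 1) <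
        ∑ y ∈ Y, (A₀.card + 2 ^ (k + 1) * A₀.card * (Z y).card) := by
      refine Finset.sum_lt_sum_of_nonempty hYne fun y hy ↦ ?_
      rcases lt_or_ge ((U y).card * 2 ^ (k + 1)) A₀.card with hl | hl
      · omega
      · have h1 : 1 ≤ (Z y).card := Finset.card_pos.2 (hcon y hy hl)
        have h2 : (U y).card ≤ A₀.card := Finset.card_filter_le _ _
        calc (U y).card * 2 ^ (k + 1) ≤ A₀.card * 2 ^ (k + 1) * 1 := by
              rw [mul_one]; gcongr
          _ ≤ A₀.card * 2 ^ (k + 1) * (Z y).card := by gcongr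
          _ = 2 ^ (k + 1) * A₀.card * (Z y).card := by ring
          _ < _ := by omega
    rw [← Finset.sum_mul, Finset.sum_add_distrib, ← Finset.mul_sum, Finset.sum_const,
      hYcard, smul_eq_mul] at hlt
    have h1 : 2 ^ (k + 1) * A₀.card * ∑ y ∈ Y, (Z y).card ≤ A₀.card * B.card ^ k := by
      calc _ = A₀.card * (2 ^ (k + 1) * ∑ y ∈ Y, (Z y).card) := by ring
        _ ≤ _ := by gcongr
    have h2 : (∑ y ∈ Y, (U y).card) * 2 ^ (k + 1) = 2 * (2 ^ k * ∑ y ∈ Y, (U y).card) := by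
      ring
    rw [h2, mul_comm (B.card ^ k)] at hlt
    omega
  refine ⟨a, U y, (Finset.filter_subset _ _).trans hA₀A, ?_, fun S hS hSm ↦ ?_⟩
  · calc A.card ≤ 2 * A₀.card := hA₀
      _ ≤ 2 * ((U y).card * 2 ^ (k + 1)) := by gcongr
      _ = _ := by ring
  · rcases S.eq_empty_or_nonempty with rfl | hne
    · simpa using Nat.le_mul_of_pos_right B.card (by positivity)
    · by_contra! hcon
      have : Nonempty S := hne.to_subtype
      obtain ⟨g, hg⟩ : ∃ g : Fin m → S, Function.Surjective g := by
        obtain ⟨e⟩ : Nonempty (S ↪ Fin m) :=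
          Function.Embedding.nonempty_of_card_le (by simpa using hSm)
        exact ⟨_, Function.invFun_surjective e.injective⟩
      have hmem : (fun t ↦ (g t : ℕ)) ∈ Z y := by
        have hNeq : N (fun t ↦ (g t : ℕ)) = B.filter fun y ↦ ∀ s ∈ S, c s y = a := by
          ext z
          simp only [N, Finset.mem_filter]
          refine and_congr_right fun _ ↦ ⟨fun hz s hs ↦ ?_, fun hz t ↦ hz _ (g t).2⟩
          obtain ⟨t, ht⟩ := hg ⟨s, hs⟩
          simpa [ht] using hz t
        simp only [Z, bad, Finset.mem_filter, Fintype.mem_piFinset]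
        refine ⟨⟨fun t ↦ hA₀A (Finset.mem_filter.1 (hS (g t).2)).1, ?_⟩,
          fun t ↦ hS (g t).2⟩
        rwa [hNeq]
      simp [hyZ] at hmem

lemma exists_subset_card_commonNeighbors_family (c : ℕ → ℕ → Fin 2) (J : Finset ℕ)
    (W : ℕ → Finset ℕ) (hW : ∀ j ∈ J, (W j).Nonempty) (m k : ℕ) (X : ℕ → ℕ)
    (A : Finset ℕ) (hA : A.Nonempty)
    (h : ∀ j ∈ J, A.card ^ m * 2 ^ (k + 1) ≤ 2 ^ (X j * k)) :
    ∃ a : ℕ → Fin 2, ∃ A' ⊆ A, A.card ≤ A'.card * 2 ^ ((k + 2) * J.card) ∧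
      ∀ j ∈ J, ∀ S ⊆ A', S.card ≤ m →
        (W j).card ≤ ((W j).filter fun y ↦ ∀ s ∈ S, c s y = a j).card * 2 ^ X j := by
  induction J using Finset.induction_on with
  | empty => exact ⟨fun _ ↦ 0, A, subset_rfl, by simp, by simp⟩
  | insert j J hj ih =>
    obtain ⟨a, A₁, hA₁, hcard, hcommon⟩ := ih (fun i hi ↦ hW i (Finset.mem_insert_of_mem hi))
      (fun i hi ↦ h i (Finset.mem_insert_of_mem hi))
    have hA₁ne : A₁.Nonempty := by
      rw [← Finset.card_pos]
      by_contra! h0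
      have := hA.card_pos
      simp only [Nat.le_zero.1 h0, zero_mul] at hcard
      omega
    obtain ⟨b, A₂, hA₂, hcard₂, hcommon₂⟩ := exists_subset_card_commonNeighbors c A₁ (W j) hA₁ne
      (hW j (Finset.mem_insert_self j J)) m k (X j)
      (le_trans (by gcongr) (h j (Finset.mem_insert_self j J)))
    refine ⟨Function.update a j b, A₂, hA₂.trans hA₁, ?_, fun i hi S hS hSm ↦ ?_⟩
    · calc A.card ≤ A₁.card * 2 ^ ((k + 2) * J.card) := hcard
        _ ≤ A₂.card * 2 ^ (k + 2) * 2 ^ ((k + 2) * J.card) := by gcongr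
        _ = A₂.card * 2 ^ ((k + 2) * (insert j J).card) := by
          rw [Finset.card_insert_of_notMem hj, mul_assoc, ← pow_add]; ring_nf
    · rcases Finset.mem_insert.1 hi with rfl | hi
      · simpa using hcommon₂ S hS hSm
      · have hij : i ≠ j := fun e ↦ hj (e ▸ hi)
        simpa [hij] using hcommon i hi S (hS.trans hA₂) hSm

lemma sixteen_mul_le_two_pow {T : ℕ} (hT : 3 ≤ T) : 16 * T ≤ 2 ^ (2 * T) := by
  induction T, hT using Nat.le_induction with
  | base => norm_num
  | succ n hn ih =>
    have : 2 ^ (2 * (n + 1)) = 4 * 2 ^ (2 * n) := by ring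
    omega

/-- Inside large sets `W j` one finds a pair of monochromatic cliques, one of each colour and with
large product of sizes, such that all edges between the pairs for `i` and for `j` agree. -/
theorem exists_isMonoClique_family (c : ℕ → ℕ → Fin 2) (T : ℕ) (hT : 3 ≤ T) (l : ℕ)
    (hl : l ≤ T) (W : ℕ → Finset ℕ)
    (hlower : ∀ j ∈ Finset.Ioc l T,
      2 ^ (2 ^ (8 * T * j) - 1) ≤ (W j).card * 2 ^ (l * 2 ^ (8 * T * j - 2 * T)))
    (hupper : ∀ j ∈ Finset.Ioc l T, (W j).card ≤ 2 ^ 2 ^ (8 * T * j))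
    (hclique : ∀ j ∈ Finset.Ioc l T, ∀ S ⊆ W j, ∀ a, IsMonoClique c a S →
      S.card ≤ T * 2 ^ (8 * T * j)) :
    ∃ (P : Fin 2 → ℕ → Finset ℕ) (d : ℕ → ℕ → Fin 2), ∀ j ∈ Finset.Ioc l T,
      (∀ a, P a j ⊆ W j ∧ IsMonoClique c a (P a j)) ∧
      (2 ^ (8 * T * j)) ^ 2 ≤ 256 * ((P 0 j).card * (P 1 j).card) ∧
      ∀ i ∈ Finset.Ioc l T, i < j → ∀ a b, ∀ u ∈ P a i, ∀ v ∈ P b j, c u v = d i j := by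
  induction hl using Nat.decreasingInduction generalizing W with
  | self => exact ⟨fun _ _ ↦ ∅, fun _ _ ↦ 0, by simp⟩
  | of_succ l hl ih =>
    have hmem : l + 1 ∈ Finset.Ioc l T := by simp; omega
    have hsub : Finset.Ioc (l + 1) T ⊆ Finset.Ioc l T := by
      intro j; simp only [Finset.mem_Ioc]; omega
    have hne : ∀ j ∈ Finset.Ioc l T, (W j).Nonempty := by
      intro j hj
      rw [← Finset.card_pos]
      by_contra! h0
      have := hlower j hj
      simp only [Nat.le_zero.1 h0, zero_mul] at this
      have : 0 < 2 ^ (2 ^ (8 * T * j) - 1) := by positivity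
      omega
    set M := 2 ^ (8 * T * (l + 1)) with hM
    set k := 2 ^ (8 * T * (l + 1) - 2 * T) with hk
    set E := 2 ^ (2 * T) with hE
    have hTE : 16 * T ≤ E := sixteen_mul_le_two_pow hT
    have hkM : M = k * E := by
      rw [hM, hk, hE, ← pow_add]
      congr 1
      have : 2 * T ≤ 8 * T * (l + 1) := by nlinarith
      omega
    have hk1 : 1 ≤ k := Nat.one_le_two_pow
    have hkTM : 16 * (T * k) ≤ M := by
      rw [hkM]; nlinarith
    have hkT : k ≤ T * k := Nat.le_mul_of_pos_left k (by omega)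
    obtain ⟨a, A, hAW, hAcard, hcommon⟩ := exists_subset_card_commonNeighbors_family c
      (Finset.Ioc (l + 1) T) W (fun j hj ↦ hne j (hsub hj)) (2 * T * M) k
      (fun j ↦ 2 ^ (8 * T * j - 2 * T)) (W (l + 1)) (hne _ hmem) (by
        intro j hj
        calc (W (l + 1)).card ^ (2 * T * M) * 2 ^ (k + 1)
            ≤ (2 ^ M) ^ (2 * T * M) * 2 ^ (k + 1) := by gcongr; exact hupper _ hmem
          _ = 2 ^ (M * (2 * T * M) + (k + 1)) := by rw [← pow_mul, ← pow_add]
          _ ≤ _ := by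
            apply Nat.pow_le_pow_right two_pos
            have h1 : M * E ^ 3 ≤ 2 ^ (8 * T * j - 2 * T) := by
              rw [hM, hE, ← pow_mul, ← pow_add]
              apply Nat.pow_le_pow_right two_pos
              have : 8 * T * (l + 2) ≤ 8 * T * j :=
                Nat.mul_le_mul_left _ (Finset.mem_Ioc.1 hj).1
              have : 8 * T * (l + 2) = 8 * T * (l + 1) + 8 * T := by ring
              omega
            have h2 : k ≤ M * M := (by omega : k ≤ M).trans (Nat.le_mul_self M)
            calc M * (2 * T * M) + (k + 1) ≤ M * (2 * T * M) + (M * M + M * M) := by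
                  gcongr; exact hk1.trans h2
              _ = (2 * T + 2) * (M * M) := by ring
              _ ≤ (E * E) * (M * M) := by gcongr; nlinarith
              _ = M * E ^ 2 * (k * E) := by rw [← hkM]; ring
              _ = M * E ^ 3 * k := by ring
              _ ≤ _ := by gcongr)
    have hAlower : 2 ^ (M - 1 - 4 * (T * k)) ≤ A.card := by
      refine le_of_mul_le_mul_right (a := 2 ^ (4 * (T * k))) ?_ (by positivity)
      rw [← pow_add, Nat.sub_add_cancel (by omega)]
      calc 2 ^ (M - 1) ≤ (W (l + 1)).card * 2 ^ (l * k) := hlower _ hmem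
        _ ≤ A.card * 2 ^ ((k + 2) * (Finset.Ioc (l + 1) T).card) * 2 ^ (l * k) := by gcongr
        _ = A.card * 2 ^ ((k + 2) * (Finset.Ioc (l + 1) T).card + l * k) := by
          rw [mul_assoc, ← pow_add]
        _ ≤ A.card * 2 ^ (4 * (T * k)) := by
          gcongr
          · exact one_le_two
          · rw [Nat.card_Ioc]
            calc (k + 2) * (T - (l + 1)) + l * k ≤ (3 * k) * T + T * k := by
                  gcongr <;> omega
              _ = _ := by ring
    obtain ⟨P₀, hP₀A, P₁, hP₁A, hP₀, hP₁, hP⟩ :=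
      exists_isMonoClique_card_mul_card c A M _ hAlower (by omega)
    have hS : (P₀ ∪ P₁).card ≤ 2 * T * M := by
      have h0 := hclique _ hmem P₀ (hP₀A.trans hAW) 0 hP₀
      have h1 := hclique _ hmem P₁ (hP₁A.trans hAW) 1 hP₁
      have := Finset.card_union_le P₀ P₁
      rw [← hM] at h0 h1
      linarith
    let W' : ℕ → Finset ℕ := fun j ↦ (W j).filter fun y ↦ ∀ s ∈ P₀ ∪ P₁, c s y = a j
    have hW' (j : ℕ) : W' j ⊆ W j := Finset.filter_subset _ _
    obtain ⟨P, d, hPd⟩ := ih W'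
      (fun j hj ↦ by
        calc _ ≤ (W j).card * 2 ^ (l * 2 ^ (8 * T * j - 2 * T)) := hlower j (hsub hj)
          _ ≤ (W' j).card * 2 ^ 2 ^ (8 * T * j - 2 * T) *
              2 ^ (l * 2 ^ (8 * T * j - 2 * T)) := by
            gcongr
            exact hcommon j hj _ (Finset.union_subset hP₀A hP₁A) hS
          _ = _ := by rw [mul_assoc, ← pow_add]; ring_nf)
      (fun j hj ↦ (Finset.card_le_card (hW' j)).trans (hupper j (hsub hj)))
      (fun j hj S hS ↦ hclique j (hsub hj) S (hS.trans (hW' j)))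
    refine ⟨fun b ↦ Function.update (P b) (l + 1) (if b = 0 then P₀ else P₁),
      Function.update d (l + 1) a, fun j hj ↦ ?_⟩
    by_cases hjl : j = l + 1
    · subst hjl
      refine ⟨fun b ↦ ?_, by simpa using hP, fun i hi hij ↦ ?_⟩
      · fin_cases b
        · simpa using ⟨hP₀A.trans hAW, hP₀⟩
        · simpa using ⟨hP₁A.trans hAW, hP₁⟩
      · have := (Finset.mem_Ioc.1 hi).1
        omega
    · have hj' : j ∈ Finset.Ioc (l + 1) T := by
        simp only [Finset.mem_Ioc] at hj ⊢; omega
      obtain ⟨h1, h2, h3⟩ := hPd j hj'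
      simp only [Function.update_of_ne hjl]
      refine ⟨fun b ↦ ⟨(h1 b).1.trans (hW' j), (h1 b).2⟩, h2, fun i hi hij e f u hu v hv ↦ ?_⟩
      by_cases hil : i = l + 1
      · subst hil
        simp only [Function.update_self] at hu ⊢
        refine (Finset.mem_filter.1 ((h1 f).1 hv)).2 u ?_
        split_ifs at hu <;> simp [hu]
      · rw [Function.update_of_ne hil] at hu ⊢
        have hi' : i ∈ Finset.Ioc (l + 1) T := by
          simp only [Finset.mem_Ioc] at hi ⊢; omega
        exact h3 i hi' hij e f u hu v hv

lemma add_one_le_exp_of_isMonoClique_weight_le (c : ℕ → ℕ → Fin 2) (T : ℕ) (hT : 3 ≤ T)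
    (ω : ℝ) (hωT : ω ≤ T)
    (hω : ∀ S ⊆ Finset.Icc 2 (2 ^ 2 ^ (8 * T * T)), ∀ a, IsMonoClique c a S →
      ∑ s ∈ S, 1 / Real.logb 2 (s : ℝ) ≤ ω) :
    (T : ℝ) + 1 ≤ Real.exp (32 * ω) := by
  have hω0 : 0 ≤ ω := by simpa using hω ∅ (by simp) 0 (by simp [IsMonoClique])
  let M : ℕ → ℕ := fun j ↦ 2 ^ (8 * T * j)
  let I : ℕ → Finset ℕ := fun j ↦ Finset.Ico (2 ^ (M j - 1)) (2 ^ M j)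
  have hMpos (j : ℕ) : (0 : ℝ) < M j := by simp [M]
  have hM2 : ∀ j ∈ Finset.Ioc 0 T, 2 ≤ M j := by
    intro j hj
    refine Nat.le_self_pow ?_ 2
    have := (Finset.mem_Ioc.1 hj).1
    positivity
  have hI : ∀ j ∈ Finset.Ioc 0 T, ∀ s ∈ I j,
      s ∈ Finset.Icc 2 (2 ^ 2 ^ (8 * T * T)) ∧ 1 / (M j : ℝ) ≤ 1 / Real.logb 2 (s : ℝ) := by
    intro j hj s hs
    obtain ⟨h1, h2⟩ := Finset.mem_Ico.1 hs
    have hs2 : 2 ≤ s := (Nat.le_self_pow (by have := hM2 j hj; omega) 2).trans h1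
    refine ⟨Finset.mem_Icc.2 ⟨hs2, h2.le.trans ?_⟩, ?_⟩
    · have := (Finset.mem_Ioc.1 hj).2
      simp only [M]
      gcongr <;> norm_num
    · have hs2' : (1 : ℝ) < s := by exact_mod_cast hs2
      refine one_div_le_one_div_of_le (Real.logb_pos one_lt_two hs2') ?_
      rw [Real.logb_le_iff_le_rpow one_lt_two (by linarith), Real.rpow_natCast]
      exact_mod_cast h2.le
  have hIlt : ∀ i j, i < j → ∀ u ∈ I i, ∀ v ∈ I j, u < v := by
    intro i j hij u hu v hv
    refine (Finset.mem_Ico.1 hu).2.trans_le (le_trans ?_ (Finset.mem_Ico.1 hv).1)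
    refine Nat.pow_le_pow_right two_pos (Nat.le_sub_one_of_lt ?_)
    exact Nat.pow_lt_pow_right one_lt_two (Nat.mul_lt_mul_of_pos_left hij (by omega))
  have hIcard (j : ℕ) : (I j).card = 2 ^ (M j - 1) := by
    have h1 : M j = M j - 1 + 1 := by
      have : 0 < M j := by simp [M]
      omega
    have h2 : 2 ^ M j = 2 * 2 ^ (M j - 1) := by
      conv_lhs => rw [h1, pow_succ, mul_comm]
    simp only [I, Nat.card_Ico]
    omega
  have hweight : ∀ j ∈ Finset.Ioc 0 T, ∀ S ⊆ I j,
      (S.card : ℝ) / M j ≤ ∑ s ∈ S, 1 / Real.logb 2 (s : ℝ) := by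
    intro j hj S hS
    calc (S.card : ℝ) / M j = ∑ s ∈ S, 1 / (M j : ℝ) := by
          rw [Finset.sum_const, nsmul_eq_mul]; ring
      _ ≤ _ := Finset.sum_le_sum fun s hs ↦ (hI j hj s (hS hs)).2
  obtain ⟨P, d, hP⟩ := exists_isMonoClique_family c T hT 0 (Nat.zero_le T) I
    (fun j _ ↦ by simp [hIcard, M])
    (fun j _ ↦ by
      rw [hIcard]
      exact Nat.pow_le_pow_right two_pos (Nat.sub_le _ _))
    (fun j hj S hS a hSa ↦ by
      have h1 := (hweight j hj S hS).trans
        ((hω S (fun s hs ↦ (hI j hj s (hS hs)).1) a hSa).trans hωT)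
      rw [div_le_iff₀ (hMpos j)] at h1
      exact_mod_cast h1)
  have hsum (a : Fin 2) (F : Finset ℕ) (hF : F ⊆ Finset.Ioc 0 T) (hFa : IsMonoClique d a F) :
      ∑ j ∈ F, 16 * ((P a j).card / (M j : ℝ)) ≤ 16 * ω := by
    have hdisj : Set.PairwiseDisjoint (F : Set ℕ) (P a) := by
      intro i hi j hj hij
      refine Finset.disjoint_left.2 fun u hui huj ↦ ?_
      have h1 := ((hP i (hF hi)).1 a).1 hui
      have h2 := ((hP j (hF hj)).1 a).1 huj
      rcases lt_or_gt_of_ne hij with h | h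
      · exact lt_irrefl u (hIlt i j h u h1 u h2)
      · exact lt_irrefl u (hIlt j i h u h2 u h1)
    have hmono : IsMonoClique c a (F.biUnion (P a)) := by
      intro u hu v hv huv
      obtain ⟨i, hi, hui⟩ := Finset.mem_biUnion.1 hu
      obtain ⟨j, hj, hvj⟩ := Finset.mem_biUnion.1 hv
      obtain ⟨h1, -, h3⟩ := hP j (hF hj)
      rcases lt_trichotomy i j with h | rfl | h
      · rw [h3 i (hF hi) h a a u hui v hvj]
        exact hFa i hi j hj h
      · exact (h1 a).2 u hui v hvj huv
      · exact absurd huv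
          (hIlt j i h v ((h1 a).1 hvj) u (((hP i (hF hi)).1 a).1 hui)).asymm
    have hle := hω (F.biUnion (P a)) (fun u hu ↦ by
      obtain ⟨i, hi, hui⟩ := Finset.mem_biUnion.1 hu
      exact (hI i (hF hi) u (((hP i (hF hi)).1 a).1 hui)).1) a hmono
    rw [Finset.sum_biUnion hdisj] at hle
    rw [← Finset.mul_sum]
    gcongr
    exact (Finset.sum_le_sum fun j hj ↦
      hweight j (hF hj) _ ((hP j (hF hj)).1 a).1).trans hle
  have hfinal := card_add_one_le_exp_of_isMonoClique_weight_le d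
    (fun j ↦ 16 * ((P 0 j).card / (M j : ℝ))) (fun j ↦ 16 * ((P 1 j).card / (M j : ℝ)))
    (Finset.Ioc 0 T) (fun j hj ↦ by
      have h1 : (M j : ℝ) ^ 2 ≤ 256 * ((P 0 j).card * (P 1 j).card) := by
        exact_mod_cast (hP j hj).2.1
      have hMj := hMpos j
      have h2 : (0 : ℝ) < (P 0 j).card * (P 1 j).card := by nlinarith [sq_pos_of_pos hMj]
      have h3 : (0 : ℝ) < (P 0 j).card := pos_of_mul_pos_left h2 (by positivity)
      have h4 : (0 : ℝ) < (P 1 j).card := pos_of_mul_pos_right h2 (by positivity)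
      refine ⟨by positivity, by positivity, ?_⟩
      have h5 : 16 * ((P 0 j).card / (M j : ℝ)) * (16 * ((P 1 j).card / (M j : ℝ))) =
          256 * ((P 0 j).card * (P 1 j).card) / (M j : ℝ) ^ 2 := by
        field_simp; norm_num
      rw [h5, one_le_div (by positivity)]
      exact h1)
    (16 * ω) (16 * ω) (hsum 0) (hsum 1)
  rw [Real.sqrt_mul_self (by positivity)] at hfinal
  calc (T : ℝ) + 1 ≤ Real.exp (2 * (16 * ω)) := by simpa using hfinal
    _ = _ := by ring_nf

/-- Theorem 1.1 of Conlon–Fox–Sudakov.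
For all sufficiently large `n`, every 2-coloring of the edges of the complete graph on
`{2, 3, ..., n}` contains a monochromatic clique `S` with
`∑_{s ∈ S} 1 / log₂ s ≥ 2⁻⁸ · log₂ log₂ log₂ n`. -/
theorem weighted_ramsey_lower_bound :
    ∃ N : ℕ, ∀ n : ℕ, N ≤ n →
      ∀ c : ℕ → ℕ → Fin 2,
        ∃ S : Finset ℕ, S ⊆ Finset.Icc 2 n ∧
          (∃ clr : Fin 2, ∀ i ∈ S, ∀ j ∈ S, i < j → c i j = clr) ∧
          (2 : ℝ) ^ (-8 : ℤ) * Real.logb 2 (Real.logb 2 (Real.logb 2 (n : ℝ))) ≤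
            ∑ s ∈ S, 1 / Real.logb 2 (s : ℝ) := by
  have htend := Real.tendsto_logb_atTop (b := 2) one_lt_two
  have hev : ∀ᶠ n : ℕ in Filter.atTop, 128 ≤ Real.logb 2 (Real.logb 2 (n : ℝ)) ∧
      1 ≤ Real.logb 2 (n : ℝ) ∧ 1 ≤ (n : ℝ) :=
    (((htend.comp htend).comp tendsto_natCast_atTop_atTop).eventually_ge_atTop 128).and
      (((htend.comp tendsto_natCast_atTop_atTop).eventually_ge_atTop 1).and
        (tendsto_natCast_atTop_atTop.eventually_ge_atTop 1))
  obtain ⟨N, hN⟩ := Filter.eventually_atTop.1 hev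
  refine ⟨N, fun n hn c ↦ ?_⟩
  obtain ⟨hℓ, hlog1, hn1⟩ := hN n hn
  set ℓ := Real.logb 2 (Real.logb 2 (n : ℝ)) with hℓdef
  have hℓ0 : 0 < ℓ := by linarith
  set q := √ℓ with hq
  have hq2 : q * q = ℓ := Real.mul_self_sqrt hℓ0.le
  have hq0 : 0 ≤ q := Real.sqrt_nonneg ℓ
  have hq11 : 11 ≤ q := by nlinarith
  set T := ⌊√(ℓ / 8)⌋₊ with hTdef
  have hsq : √(ℓ / 8) * √(ℓ / 8) = ℓ / 8 := Real.mul_self_sqrt (by positivity)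
  have hTle : (T : ℝ) ≤ √(ℓ / 8) := Nat.floor_le (Real.sqrt_nonneg _)
  have hTlt : √(ℓ / 8) < T + 1 := Nat.lt_floor_add_one _
  have hqT : q / 3 < T + 1 := by
    refine lt_of_le_of_lt (Real.le_sqrt_of_sq_le ?_) hTlt
    nlinarith
  have hT3 : 3 ≤ T := by
    refine Nat.le_floor ?_
    refine Real.le_sqrt_of_sq_le ?_
    push_cast
    linarith
  by_contra! hcon
  set ω := (2 : ℝ) ^ (-8 : ℤ) * Real.logb 2 ℓ with hωdef
  have hω256 : ω * 256 = Real.logb 2 ℓ := by rw [hωdef]; norm_num; ring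
  have hlog2 : 1 / 2 ≤ Real.log 2 := by linarith [Real.log_two_gt_d9]
  have hωlog : ω * 256 * Real.log 2 = 2 * Real.log q := by
    rw [hω256, Real.logb, div_mul_cancel₀ _ (by positivity), ← hq2,
      Real.log_mul (by positivity) (by positivity)]
    ring
  have hω0 : 0 ≤ ω := by
    have := Real.logb_nonneg one_lt_two (by linarith : 1 ≤ ℓ)
    linarith
  have hlogq : Real.log q ≤ q := Real.log_le_self hq0
  have hω64 : ω * 64 ≤ Real.log q := by nlinarith
  have hnT : 2 ^ 2 ^ (8 * T * T) ≤ n := by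
    have h1 : ((8 * T * T : ℕ) : ℝ) ≤ ℓ := by
      push_cast
      nlinarith [(Nat.cast_nonneg T : (0 : ℝ) ≤ T)]
    rw [hℓdef, Real.le_logb_iff_rpow_le one_lt_two (by linarith), Real.rpow_natCast] at h1
    have h2 : ((2 ^ (8 * T * T) : ℕ) : ℝ) ≤ Real.logb 2 n := by exact_mod_cast h1
    rw [Real.le_logb_iff_rpow_le one_lt_two (by linarith), Real.rpow_natCast] at h2
    exact_mod_cast h2
  have hexp := add_one_le_exp_of_isMonoClique_weight_le c T hT3 ω (by linarith)
    fun S hS a hSa ↦ (hcon S (hS.trans (Finset.Icc_subset_Icc le_rfl hnT)) ⟨a, hSa⟩).le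
  have h1 : Real.exp (32 * ω) ^ 2 ≤ q := by
    rw [← Real.exp_nat_mul, ← Real.le_log_iff_exp_le (by positivity)]
    push_cast
    linarith
  nlinarith [Real.exp_pos (32 * ω)]
end

section
/- Let k, q ≥ 2 be integers and let π be a permutation of {1, 2, ..., k-1}. Then every q-coloring of the edges of the complete graph on the vertex set {1, 2, ..., n} with n = 2^(k^(20q)) contains a monochromatic clique with vertices a₁ < a₂ < ... < a_k satisfying a_{π(1)+1} - a_{π(1)} > a_{π(2)+1} - a_{π(2)} > ... > a_{π(k-1)+1} - a_{π(k-1)}. -/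
open Finset

/-- The number of pairs in `X × Y` satisfying the relation `R`. -/
noncomputable def pairCount (R : ℕ → ℕ → Prop) (X Y : Finset ℕ) : ℕ :=
  open Classical in ∑ x ∈ X, #{y ∈ Y | R x y}

/-- `A` lies in a dyadic block of length at least `2 ^ h`, and has density at least `2 ^ (-d)`
in this block. -/
def Thick (h d : ℕ) (A : Finset ℕ) : Prop :=
  ∃ H, h ≤ H ∧ (∃ i, ∀ x ∈ A, x / 2 ^ H = i) ∧ 2 ^ H ≤ #A * 2 ^ d

/-- Every element of `Y` exceeds every element of `X` by at least `2 ^ h`. -/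
def FarBelow (h : ℕ) (X Y : Finset ℕ) : Prop :=
  ∀ x ∈ X, ∀ y ∈ Y, x + 2 ^ h ≤ y

theorem Thick.card_pos {h d : ℕ} {A : Finset ℕ} (hA : Thick h d A) : 0 < #A := by
  obtain ⟨H, -, -, h2⟩ := hA
  by_contra hc
  have : #A = 0 := by omega
  rw [this, zero_mul] at h2
  have := Nat.two_pow_pos H
  omega

theorem Thick.nonempty {h d : ℕ} {A : Finset ℕ} (hA : Thick h d A) : A.Nonempty :=
  Finset.card_pos.mp hA.card_pos

theorem Thick.mono {h h' d d' : ℕ} {A : Finset ℕ} (hA : Thick h d A) (hh : h' ≤ h)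
    (hd : d ≤ d') : Thick h' d' A := by
  obtain ⟨H, h1, h2, h3⟩ := hA
  exact ⟨H, hh.trans h1, h2, h3.trans (Nat.mul_le_mul_left _ (Nat.pow_le_pow_right (by norm_num) hd))⟩

theorem Thick.of_subset {h d e : ℕ} {A B : Finset ℕ} (hA : Thick h d A) (hBA : B ⊆ A)
    (hc : #A ≤ 2 ^ e * #B) : Thick h (d + e) B := by
  obtain ⟨H, h1, ⟨i, h2⟩, h3⟩ := hA
  refine ⟨H, h1, ⟨i, fun x hx => h2 x (hBA hx)⟩, h3.trans ?_⟩
  calc #A * 2 ^ d ≤ 2 ^ e * #B * 2 ^ d := Nat.mul_le_mul_right _ hc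
    _ = #B * 2 ^ (d + e) := by ring

/-- Inside a thick set there is an equally thick subset in a dyadic block of any smaller
length. -/
theorem exists_dense_subblock {H h d i : ℕ} {A : Finset ℕ} (hh : h ≤ H)
    (hi : ∀ x ∈ A, x / 2 ^ H = i) (hA : 2 ^ H ≤ #A * 2 ^ d) :
    ∃ j, 2 ^ h ≤ #{x ∈ A | x / 2 ^ h = j} * 2 ^ d := by
  by_contra! hc
  obtain ⟨t, rfl⟩ := Nat.exists_eq_add_of_le hh
  have hmaps : ∀ x ∈ A, x / 2 ^ h ∈ Finset.Ico (i * 2 ^ t) ((i + 1) * 2 ^ t) := by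
    intro x hx
    have h1 := hi x hx
    rw [pow_add, ← Nat.div_div_eq_div_mul] at h1
    have h2 : 0 < 2 ^ t := Nat.two_pow_pos t
    rw [Finset.mem_Ico]
    constructor
    · exact (Nat.le_div_iff_mul_le h2).mp h1.ge
    · exact (Nat.div_lt_iff_lt_mul h2).mp (by omega)
  have hne : (Finset.Ico (i * 2 ^ t) ((i + 1) * 2 ^ t)).Nonempty := by
    rw [Finset.nonempty_Ico, add_mul, one_mul]
    have := Nat.two_pow_pos t
    omega
  have hsum := Finset.card_eq_sum_card_fiberwise (f := fun x => x / 2 ^ h) (s := A)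
    (t := Finset.Ico (i * 2 ^ t) ((i + 1) * 2 ^ t)) hmaps
  have : #A * 2 ^ d < 2 ^ (h + t) := by
    rw [hsum, Finset.sum_mul]
    calc _ < ∑ _j ∈ Finset.Ico (i * 2 ^ t) ((i + 1) * 2 ^ t), 2 ^ h :=
          Finset.sum_lt_sum_of_nonempty hne fun j _ => hc j
      _ = 2 ^ (h + t) := by
          rw [Finset.sum_const, Nat.card_Ico, ← Nat.sub_mul, smul_eq_mul]
          simp [pow_add, mul_comm]
  omega

theorem card_block_le (A : Finset ℕ) (h j : ℕ) : #{x ∈ A | x / 2 ^ h = j} ≤ 2 ^ h := by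
  have hp := Nat.two_pow_pos h
  calc #{x ∈ A | x / 2 ^ h = j} ≤ #(Finset.Ico (j * 2 ^ h) ((j + 1) * 2 ^ h)) := by
        refine card_le_card fun x hx => ?_
        rw [mem_filter] at hx
        rw [Finset.mem_Ico]
        exact ⟨(Nat.le_div_iff_mul_le hp).mp hx.2.ge,
          (Nat.div_lt_iff_lt_mul hp).mp (by omega)⟩
    _ = 2 ^ h := by rw [Nat.card_Ico, ← Nat.sub_mul]; simp

theorem farBelow_blocks (A B : Finset ℕ) {h i j : ℕ} (hij : i + 2 ≤ j) :
    FarBelow h {x ∈ A | x / 2 ^ h = i} {x ∈ B | x / 2 ^ h = j} := by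
  intro x hx y hy
  rw [mem_filter] at hx hy
  have hp := Nat.two_pow_pos h
  have h1 : x < (i + 1) * 2 ^ h := (Nat.div_lt_iff_lt_mul hp).mp (by omega)
  have h2 : j * 2 ^ h ≤ y := (Nat.le_div_iff_mul_le hp).mp hy.2.ge
  have h3 : (i + 2) * 2 ^ h ≤ j * 2 ^ h := Nat.mul_le_mul_right _ hij
  nlinarith

/-- A thick set contains two thick subsets far below one another. -/
theorem Thick.exists_farBelow {h d : ℕ} {A : Finset ℕ} (hA : Thick h d A) (hd : d + 3 ≤ h) :
    ∃ h', h ≤ h' + (d + 3) ∧ ∃ X ⊆ A, ∃ Y ⊆ A,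
      Thick h' (d + 1) X ∧ Thick h' (d + 1) Y ∧ FarBelow h' X Y := by
  obtain ⟨H, h1, ⟨i, h2⟩, h3⟩ := hA
  obtain ⟨t, rfl⟩ := Nat.exists_eq_add_of_le (hd.trans h1)
  have ht : t ≤ d + 3 + t := by omega
  obtain ⟨j, hj⟩ := exists_dense_subblock ht h2 h3
  set B := {x ∈ A | x / 2 ^ t + 1 ≠ j ∧ x / 2 ^ t ≠ j ∧ x / 2 ^ t ≠ j + 1} with hB
  have hBA : B ⊆ A := filter_subset _ _
  have hcover : A ⊆ B ∪ ({x ∈ A | x / 2 ^ t = j - 1} ∪ ({x ∈ A | x / 2 ^ t = j} ∪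
      {x ∈ A | x / 2 ^ t = j + 1})) := by
    intro x hx
    simp only [hB, mem_union, mem_filter, hx, true_and]
    generalize x / 2 ^ t = v
    omega
  have hcard : #A ≤ #B + 3 * 2 ^ t := by
    have e1 := card_block_le A t (j - 1)
    have e2 := card_block_le A t j
    have e3 := card_block_le A t (j + 1)
    have e4 := card_le_card hcover
    have e5 := card_union_le B ({x ∈ A | x / 2 ^ t = j - 1} ∪ ({x ∈ A | x / 2 ^ t = j} ∪
      {x ∈ A | x / 2 ^ t = j + 1}))
    have e6 := card_union_le {x ∈ A | x / 2 ^ t = j - 1} ({x ∈ A | x / 2 ^ t = j} ∪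
      {x ∈ A | x / 2 ^ t = j + 1})
    have e7 := card_union_le {x ∈ A | x / 2 ^ t = j} {x ∈ A | x / 2 ^ t = j + 1}
    omega
  have h8 : 8 * 2 ^ t ≤ #A := by
    have : 2 ^ d * (8 * 2 ^ t) ≤ 2 ^ d * #A := by
      calc 2 ^ d * (8 * 2 ^ t) = 2 ^ (d + 3 + t) := by ring
        _ ≤ #A * 2 ^ d := h3
        _ = _ := mul_comm _ _
    exact Nat.le_of_mul_le_mul_left this (Nat.two_pow_pos d)
  have hBd : 2 ^ (d + 3 + t) ≤ #B * 2 ^ (d + 1) := by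
    calc 2 ^ (d + 3 + t) ≤ #A * 2 ^ d := h3
      _ ≤ (2 * #B) * 2 ^ d := Nat.mul_le_mul_right _ (by omega)
      _ = _ := by ring
  obtain ⟨l, hl⟩ := exists_dense_subblock ht (fun x hx => h2 x (hBA hx)) hBd
  have thickX : Thick t (d + 1) {x ∈ A | x / 2 ^ t = j} :=
    Thick.mono ⟨t, le_rfl, ⟨j, fun x hx => (mem_filter.mp hx).2⟩, hj⟩ le_rfl (Nat.le_succ d)
  have thickY : Thick t (d + 1) {x ∈ B | x / 2 ^ t = l} :=
    ⟨t, le_rfl, ⟨l, fun x hx => (mem_filter.mp hx).2⟩, hl⟩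
  obtain ⟨y, hy⟩ := thickY.nonempty
  have hyl := mem_filter.mp hy
  have hyB := (mem_filter.mp hyl.1).2
  rw [hyl.2] at hyB
  have hXA : {x ∈ A | x / 2 ^ t = j} ⊆ A := filter_subset _ _
  have hYA : {x ∈ B | x / 2 ^ t = l} ⊆ A := (filter_subset _ _).trans hBA
  refine ⟨t, by omega, ?_⟩
  rcases (by omega : j + 2 ≤ l ∨ l + 2 ≤ j) with hjl | hjl
  · exact ⟨_, hXA, _, hYA, thickX, thickY, farBelow_blocks _ _ hjl⟩
  · exact ⟨_, hYA, _, hXA, thickY, thickX, farBelow_blocks _ _ hjl⟩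

theorem pairCount_comm {R : ℕ → ℕ → Prop} (hR : ∀ x y, R x y → R y x) (X Y : Finset ℕ) :
    pairCount R X Y = pairCount R Y X := by
  classical
  have hR' : ∀ x y, R x y ↔ R y x := fun x y => ⟨hR x y, hR y x⟩
  unfold pairCount
  simp only [card_filter]
  rw [sum_comm]
  refine sum_congr rfl fun x _ => sum_congr rfl fun y _ => ?_
  simp only [hR' y x]

theorem pairCount_mono (R : ℕ → ℕ → Prop) {X X' Y Y' : Finset ℕ} (hX : X ⊆ X') (hY : Y ⊆ Y') :
    pairCount R X Y ≤ pairCount R X' Y' := by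
  classical
  unfold pairCount
  exact (sum_le_sum fun x _ => card_le_card (filter_subset_filter _ hY)).trans
    (sum_le_sum_of_subset hX)

/-- Either a family of sets has a transversal that is a clique of the relation `R`, or two of its
members have large subsets between which `R` has density at most `1 / M`. -/
theorem exists_transversal_or_sparse (R : ℕ → ℕ → Prop) {M : ℕ} (hM : 0 < M) (n : ℕ) :
    ∀ (s : ℕ) (A : ℕ → Finset ℕ), n ≤ M → (∀ r, s ≤ r → r < s + n → (A r).Nonempty) →
    (∃ a : ℕ → ℕ, (∀ r, s ≤ r → r < s + n → a r ∈ A r) ∧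
      ∀ r t, s ≤ r → r < t → t < s + n → R (a r) (a t)) ∨
    ∃ r t, s ≤ r ∧ r < t ∧ t < s + n ∧ ∃ X ⊆ A r, ∃ Y ⊆ A t,
      #(A r) ≤ M ^ n * #X ∧ #(A t) ≤ M ^ n * #Y ∧ M * pairCount R X Y ≤ #X * #Y := by
  classical
  induction n with
  | zero => exact fun s A _ _ => Or.inl ⟨id, fun r h1 h2 => by omega, fun r t h1 h2 h3 => by omega⟩
  | succ n ih =>
    intro s A hn hA
    by_cases hx : ∃ x ∈ A s, ∀ t, s < t → t < s + (n + 1) → #(A t) ≤ M * #{y ∈ A t | R x y}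
    · obtain ⟨x, hxs, hx⟩ := hx
      rcases ih (s + 1) (fun t => {y ∈ A t | R x y}) (by omega) (by
        intro r h1 h2
        have h3 := hx r (by omega) (by omega)
        have h4 := (hA r (by omega) (by omega)).card_pos
        rw [← card_pos]
        by_contra hc
        rw [Nat.eq_zero_of_not_pos hc] at h3
        omega) with ⟨a, ha, hR⟩ | ⟨r, t, h1, h2, h3, X, hX, Y, hY, h4, h5, h6⟩
      · left
        refine ⟨fun r => if r = s then x else a r, fun r h1 h2 => ?_, fun r t h1 h2 h3 => ?_⟩
        · by_cases hr : r = s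
          · simpa [hr] using hxs
          · simpa [hr] using (mem_filter.mp (ha r (by omega) (by omega))).1
        · have ht : t ≠ s := by omega
          by_cases hr : r = s
          · simpa [hr, ht] using (mem_filter.mp (ha t (by omega) (by omega))).2
          · simpa [hr, ht] using hR r t (by omega) h2 (by omega)
      · right
        have key : ∀ (u : ℕ) (Z : Finset ℕ), s < u → u < s + (n + 1) → #{y ∈ A u | R x y} ≤ M ^ n * #Z →
            #(A u) ≤ M ^ (n + 1) * #Z := fun u Z e1 e2 e3 =>
          calc #(A u) ≤ M * #{y ∈ A u | R x y} := hx u e1 e2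
            _ ≤ M * (M ^ n * #Z) := Nat.mul_le_mul_left _ e3
            _ = _ := by ring
        exact ⟨r, t, by omega, h2, by omega, X, hX.trans (filter_subset _ _), Y,
          hY.trans (filter_subset _ _), key r X (by omega) (by omega) h4,
          key t Y (by omega) (by omega) h5, h6⟩
    · right
      push Not at hx
      set B : ℕ → Finset ℕ := fun t => {x ∈ A s | M * #{y ∈ A t | R x y} < #(A t)} with hB
      have hcover : A s ⊆ (Finset.Ioo s (s + (n + 1))).biUnion B := by
        intro x hxs
        obtain ⟨t, h1, h2, h3⟩ := hx x hxs
        exact mem_biUnion.mpr ⟨t, Finset.mem_Ioo.mpr ⟨h1, h2⟩, mem_filter.mpr ⟨hxs, h3⟩⟩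
      have hpos := (hA s le_rfl (by omega)).card_pos
      obtain ⟨t, ht, htc⟩ : ∃ t ∈ Finset.Ioo s (s + (n + 1)), #(A s) ≤ n * #(B t) := by
        by_contra! hc
        have h1 : #(A s) ≤ ∑ t ∈ Finset.Ioo s (s + (n + 1)), #(B t) :=
          (card_le_card hcover).trans card_biUnion_le
        have h2 : n * ∑ t ∈ Finset.Ioo s (s + (n + 1)), #(B t) ≤ n * (#(A s) - 1) := by
          rw [mul_sum]
          refine (sum_le_card_nsmul _ _ (#(A s) - 1) fun t ht => ?_).trans ?_
          · have := hc t ht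
            omega
          · simp
        have hn0 : 0 < n := by
          by_contra h0
          have : n = 0 := by omega
          subst this
          obtain ⟨x, hxs⟩ := card_pos.mp hpos
          obtain ⟨t, h3, h4, -⟩ := hx x hxs
          omega
        have := Nat.le_of_mul_le_mul_left h2 hn0
        omega
      rw [Finset.mem_Ioo] at ht
      have hMn : 0 < M ^ n := Nat.pow_pos hM
      refine ⟨s, t, le_rfl, ht.1, ht.2, B t, filter_subset _ _, A t, Subset.rfl, ?_, ?_, ?_⟩
      · refine htc.trans (Nat.mul_le_mul_right _ ?_)
        rw [pow_succ]
        nlinarith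
      · exact Nat.le_mul_of_pos_left _ (Nat.pow_pos hM)
      · unfold pairCount
        rw [mul_sum, ← smul_eq_mul (#(B t))]
        exact sum_le_card_nsmul _ _ _ fun x hx => (mem_filter.mp hx).2.le

/-- Most vertices of `C` have small degree to every member of a sparse family. -/
theorem exists_low_degree_subset (R : ℕ → ℕ → Prop) {k : ℕ} {η : ℝ} {C : Finset ℕ}
    {A : ℕ → Finset ℕ} {S : Finset ℕ} (hS : #S ≤ k) (hk : 0 < k)
    (hsparse : ∀ r ∈ S, (pairCount R C (A r) : ℝ) ≤ η * #C * #(A r)) :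
    ∃ B ⊆ C, #C ≤ 2 * #B ∧ ∀ X ⊆ B, ∀ r ∈ S,
      (pairCount R X (A r) : ℝ) ≤ 2 * k * η * #X * #(A r) := by
  classical
  set bad : ℕ → Finset ℕ := fun r =>
    {x ∈ C | 2 * k * η * #(A r) < (#{y ∈ A r | R x y} : ℝ)} with hbad
  have hbadcard : ∀ r ∈ S, 2 * k * #(bad r) ≤ #C := by
    intro r hr
    by_contra! hc
    have hne : (bad r).Nonempty := by
      rw [← card_pos]
      by_contra h0
      rw [Nat.eq_zero_of_not_pos h0] at hc
      omega
    have h1 : (#(bad r) : ℝ) * (2 * k * η * #(A r)) < pairCount R C (A r) := by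
      calc (#(bad r) : ℝ) * (2 * k * η * #(A r))
          = ∑ _x ∈ bad r, (2 * k * η * #(A r)) := by rw [sum_const, nsmul_eq_mul]
        _ < ∑ x ∈ bad r, (#{y ∈ A r | R x y} : ℝ) :=
            sum_lt_sum_of_nonempty hne fun x hx => (mem_filter.mp hx).2
        _ ≤ ∑ x ∈ C, (#{y ∈ A r | R x y} : ℝ) :=
            sum_le_sum_of_subset_of_nonneg (filter_subset _ _) fun _ _ _ => Nat.cast_nonneg _
        _ = pairCount R C (A r) := by simp [pairCount]
    have h2 := hsparse r hr
    have h3 : (#C : ℝ) ≤ 2 * k * #(bad r) := by exact_mod_cast hc.le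
    have hη : 0 ≤ η * #(A r) := by
      by_contra! hneg
      have h4 : (0 : ℝ) ≤ pairCount R C (A r) := Nat.cast_nonneg _
      have h5 : (0 : ℝ) < #C := by
        have : (bad r).card ≤ #C := card_le_card (filter_subset _ _)
        have h6 := hne.card_pos
        exact_mod_cast (by omega : 0 < #C)
      nlinarith
    nlinarith [mul_le_mul_of_nonneg_right h3 hη]
  refine ⟨C \ S.biUnion bad, sdiff_subset, ?_, ?_⟩
  · have h1 : #(S.biUnion bad) ≤ ∑ r ∈ S, #(bad r) := card_biUnion_le
    have h2 : 2 * k * ∑ r ∈ S, #(bad r) ≤ k * #C := by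
      rw [mul_sum]
      refine (sum_le_card_nsmul _ _ _ hbadcard).trans ?_
      rw [smul_eq_mul]
      exact Nat.mul_le_mul_right _ hS
    have h3 : 2 * ∑ r ∈ S, #(bad r) ≤ #C :=
      Nat.le_of_mul_le_mul_left (by linarith) hk
    have h4 := le_card_sdiff (S.biUnion bad) C
    omega
  · intro X hX r hr
    have : ∀ x ∈ X, (#{y ∈ A r | R x y} : ℝ) ≤ 2 * k * η * #(A r) := by
      intro x hx
      have hxB := mem_sdiff.mp (hX hx)
      by_contra! hc
      exact hxB.2 (mem_biUnion.mpr ⟨r, hr, mem_filter.mpr ⟨hxB.1, hc⟩⟩)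
    calc (pairCount R X (A r) : ℝ) = ∑ x ∈ X, (#{y ∈ A r | R x y} : ℝ) := by simp [pairCount]
      _ ≤ #X • (2 * k * η * #(A r)) := sum_le_card_nsmul _ _ _ this
      _ = _ := by rw [nsmul_eq_mul]; ring

/-- Every thick subset of `V` contains two thick subsets, far below one another, between which the
relation `R` has density at most `η`. The density exponent grows by at most `g` (and the
assertion is made only while it stays below `D`), and at most `s` dyadic scales are used up. -/
def HasSparsePairs (R : ℕ → ℕ → Prop) (V : Finset ℕ) (η : ℝ) (D g s : ℕ) : Prop :=
  ∀ A ⊆ V, ∀ h d, Thick h d A → d + g ≤ D → s ≤ h → ∃ h', h ≤ h' + s ∧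
    ∃ X ⊆ A, ∃ Y ⊆ A, Thick h' (d + g) X ∧ Thick h' (d + g) Y ∧ FarBelow h' X Y ∧
      (pairCount R X Y : ℝ) ≤ η * #X * #Y

/-- A family `A 1, ..., A k` of thick subsets of `V`, pairwise equal or sparse in `R`, in which the
gaps `π 1, ..., π i` (between `A (π j)` and `A (π j + 1)`) have been opened in decreasing order. -/
structure OpenedGaps (R : ℕ → ℕ → Prop) (V : Finset ℕ) (k : ℕ) (π : ℕ → ℕ) (i : ℕ)
    (A : ℕ → Finset ℕ) (h d : ℕ) (η : ℝ) : Prop where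
  subset : ∀ r, A r ⊆ V
  thick : ∀ r, Thick h d (A r)
  separated : ∀ r s, r < s → A r = A s ∨ FarBelow h (A r) (A s)
  closed : ∀ j, i < j → j ≤ k - 1 → A (π j) = A (π j + 1)
  opened : ∀ j, 1 ≤ j → j ≤ i → FarBelow h (A (π j)) (A (π j + 1))
  decreasing : ∀ j l, 1 ≤ j → j < l → l ≤ i → ∀ x ∈ A (π j), ∀ y ∈ A (π j + 1),
    ∀ z ∈ A (π l), ∀ w ∈ A (π l + 1), w + x < y + z
  sparse : ∀ r ∈ Finset.Icc 1 k, ∀ s ∈ Finset.Icc 1 k, A r ≠ A s →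
    (pairCount R (A r) (A s) : ℝ) ≤ η * #(A r) * #(A s)

theorem FarBelow.mono {h h' : ℕ} {X X' Y Y' : Finset ℕ} (H : FarBelow h X Y) (hh : h' ≤ h)
    (hX : X' ⊆ X) (hY : Y' ⊆ Y) : FarBelow h' X' Y' := fun x hx y hy =>
  (Nat.add_le_add_left (Nat.pow_le_pow_right (by norm_num) hh) x).trans (H x (hX hx) y (hY hy))

theorem lt_add_of_div_two_pow_eq {x y h j : ℕ} (hx : x / 2 ^ h = j) (hy : y / 2 ^ h = j) :
    y < x + 2 ^ h := by
  have hp := Nat.two_pow_pos h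
  have h1 : j * 2 ^ h ≤ x := (Nat.le_div_iff_mul_le hp).mp hx.ge
  have h2 : y < (j + 1) * 2 ^ h := (Nat.div_lt_iff_lt_mul hp).mp (by omega)
  linarith [add_mul j 1 (2 ^ h)]

/-- Opening one more gap. -/
theorem OpenedGaps.step {R : ℕ → ℕ → Prop} (hR : ∀ x y, R x y → R y x) {V : Finset ℕ}
    {k i h d D g s : ℕ} {π : ℕ → ℕ} (hπ : Set.BijOn π (Set.Icc 1 (k - 1)) (Set.Icc 1 (k - 1)))
    {A : ℕ → Finset ℕ} {η₀ η : ℝ} (hη₀ : 0 ≤ η₀) (hη : η₀ ≤ η)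
    (hpairs : HasSparsePairs R V η₀ D g s) (hA : OpenedGaps R V k π i A h d η)
    (hi : i + 1 ≤ k - 1) (hd : d + (g + 1) ≤ D) (hs : s ≤ h) :
    ∃ A' h', h ≤ h' + s ∧ OpenedGaps R V k π (i + 1) A' h' (d + (g + 1)) (2 * k * η) := by
  have hk : 0 < k := by omega
  have hkR : (1 : ℝ) ≤ k := by exact_mod_cast hk
  have hη0 : 0 ≤ η := hη₀.trans hη
  have hηk : η ≤ 2 * k * η := by nlinarith
  have hi_mem : i + 1 ∈ Set.Icc 1 (k - 1) := ⟨by omega, hi⟩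
  set p := π (i + 1) with hp
  have hp_mem : p ∈ Set.Icc 1 (k - 1) := hπ.mapsTo hi_mem
  have hpk : p ∈ Finset.Icc 1 k := Finset.mem_Icc.mpr ⟨hp_mem.1, hp_mem.2.trans (by omega)⟩
  have hpp : A p = A (p + 1) := hA.closed (i + 1) (by omega) hi
  -- restrict `A p` to vertices of small degree, then to a dyadic block of length `2 ^ h`
  obtain ⟨B, hBC, hBcard, hBdeg⟩ := exists_low_degree_subset R (C := A p) (A := A) (η := η)
    (S := {r ∈ Finset.Icc 1 k | A r ≠ A p})
    ((card_filter_le _ _).trans (by simp)) hk fun r hr =>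
      hA.sparse p hpk r (mem_filter.mp hr).1 (mem_filter.mp hr).2.symm
  obtain ⟨H, hH, ⟨b, hb⟩, hBd⟩ := (hA.thick p).of_subset (e := 1) hBC (by simpa using hBcard)
  obtain ⟨j, hj⟩ := exists_dense_subblock hH hb hBd
  set C := {x ∈ B | x / 2 ^ h = j} with hC
  have hCj : ∀ x ∈ C, x / 2 ^ h = j := fun x hx => (mem_filter.mp hx).2
  have hCB : C ⊆ B := filter_subset _ _
  obtain ⟨h', hh', X, hXC, Y, hYC, hX, hY, hXY, hXYs⟩ :=
    hpairs C (hCB.trans (hBC.trans (hA.subset p))) h (d + 1) ⟨h, le_rfl, ⟨j, hCj⟩, hj⟩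
      (by omega) hs
  have hd' : d + 1 + g = d + (g + 1) := by omega
  rw [hd'] at hX hY
  have hle : h' ≤ h := by
    obtain ⟨x, hx⟩ := hX.nonempty
    obtain ⟨y, hy⟩ := hY.nonempty
    have h1 := hXY x hx y hy
    have h2 := lt_add_of_div_two_pow_eq (hCj x (hXC hx)) (hCj y (hYC hy))
    by_contra! hc
    have := Nat.pow_le_pow_right (n := 2) (by norm_num) hc.le
    omega
  have hXA : X ⊆ A p := hXC.trans (hCB.trans hBC)
  have hYA : Y ⊆ A p := hYC.trans (hCB.trans hBC)
  set A' : ℕ → Finset ℕ := fun r => if A r = A p then (if r ≤ p then X else Y) else A r with hA'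
  have hin_le : ∀ r, A r = A p → r ≤ p → A' r = X := fun r h1 h2 => by simp [hA', h1, h2]
  have hin_gt : ∀ r, A r = A p → p < r → A' r = Y := fun r h1 h2 => by
    simp [hA', h1, Nat.not_le.mpr h2]
  have hout : ∀ r, A r ≠ A p → A' r = A r := fun r h1 => by simp [hA', h1]
  have hin : ∀ r, A r = A p → A' r ⊆ B ∧ A' r ⊆ A p ∧ Thick h' (d + (g + 1)) (A' r) := by
    intro r hr
    rcases Nat.lt_or_ge p r with h1 | h1
    · rw [hin_gt r hr h1]; exact ⟨hYC.trans hCB, hYA, hY⟩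
    · rw [hin_le r hr h1]; exact ⟨hXC.trans hCB, hXA, hX⟩
  have hsub : ∀ r, A' r ⊆ A r := by
    intro r
    by_cases hr : A r = A p
    · rw [hr]; exact (hin r hr).2.1
    · rw [hout r hr]
  have hp' : A' p = X := hin_le p rfl le_rfl
  have hp1' : A' (p + 1) = Y := hin_gt (p + 1) hpp.symm (Nat.lt_succ_self p)
  have hmixed : ∀ r s, s ∈ Finset.Icc 1 k → A r = A p → A s ≠ A p →
      (pairCount R (A' r) (A' s) : ℝ) ≤ 2 * k * η * #(A' r) * #(A' s) := by
    intro r s hs hr hsp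
    rw [hout s hsp]
    exact hBdeg _ (hin r hr).1 s (mem_filter.mpr ⟨hs, hsp⟩)
  have hXY' : (pairCount R X Y : ℝ) ≤ 2 * k * η * #X * #Y :=
    hXYs.trans (by gcongr; exact hη.trans hηk)
  refine ⟨A', h', hh', ⟨fun r => (hsub r).trans (hA.subset r), fun r => ?_, fun r s hrs => ?_,
    fun l h1 h2 => ?_, fun l h1 h2 => ?_, fun l m h1 h2 h3 => ?_, fun r hr s hs hne => ?_⟩⟩
  · by_cases hr : A r = A p
    · exact (hin r hr).2.2
    · rw [hout r hr]
      exact (hA.thick r).mono hle (by omega)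
  · by_cases hr : A r = A p
    · by_cases hs : A s = A p
      · rcases Nat.lt_or_ge p r with h1 | h1
        · left
          rw [hin_gt r hr h1, hin_gt s hs (h1.trans hrs)]
        · rcases Nat.lt_or_ge p s with h2 | h2
          · right
            rw [hin_le r hr h1, hin_gt s hs h2]
            exact hXY
          · left
            rw [hin_le r hr h1, hin_le s hs h2]
      · right
        exact ((hA.separated r s hrs).resolve_left (by rw [hr]; exact Ne.symm hs)).mono hle
          (hsub r) (hsub s)
    · rcases hA.separated r s hrs with h1 | h1
      · left
        rw [hout r hr, hout s (h1 ▸ hr), h1]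
      · exact Or.inr (h1.mono hle (hsub r) (hsub s))
  · have h3 := hA.closed l (by omega) h2
    have hne : π l ≠ p := fun h4 => by
      have := hπ.injOn (⟨by omega, h2⟩ : l ∈ Set.Icc 1 (k - 1)) hi_mem h4
      omega
    by_cases hl : A (π l) = A p
    · rcases Nat.lt_or_ge p (π l) with h4 | h4
      · rw [hin_gt _ hl h4, hin_gt _ (h3 ▸ hl) (by omega)]
      · rw [hin_le _ hl h4, hin_le _ (h3 ▸ hl) (by omega)]
    · rw [hout _ hl, hout _ (h3 ▸ hl), h3]
  · rcases Nat.lt_or_ge i l with h3 | h3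
    · obtain rfl : l = i + 1 := by omega
      rw [← hp, hp', hp1']
      exact hXY
    · exact (hA.opened l h1 h3).mono hle (hsub _) (hsub _)
  · intro x hx y hy z hz w hw
    rcases Nat.lt_or_ge i m with h4 | h4
    · obtain rfl : m = i + 1 := by omega
      rw [← hp] at hz hw
      rw [hp'] at hz
      rw [hp1'] at hw
      have h5 := hA.opened l h1 (by omega) x (hsub _ hx) y (hsub _ hy)
      have h6 := lt_add_of_div_two_pow_eq (hCj z (hXC hz)) (hCj w (hYC hw))
      omega
    · exact hA.decreasing l m h1 h2 h4 x (hsub _ hx) y (hsub _ hy) z (hsub _ hz) w (hsub _ hw)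
  · by_cases hrp : A r = A p
    · by_cases hsp : A s = A p
      · rcases Nat.lt_or_ge p r with h1 | h1 <;> rcases Nat.lt_or_ge p s with h2 | h2
        · exact absurd (by rw [hin_gt r hrp h1, hin_gt s hsp h2]) hne
        · rw [hin_gt r hrp h1, hin_le s hsp h2, pairCount_comm hR, mul_right_comm]
          exact hXY'
        · rw [hin_le r hrp h1, hin_gt s hsp h2]
          exact hXY'
        · exact absurd (by rw [hin_le r hrp h1, hin_le s hsp h2]) hne
      · exact hmixed r s hs hrp hsp
    · by_cases hsp : A s = A p
      · rw [pairCount_comm hR, mul_right_comm]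
        exact hmixed s r hr hsp hrp
      · rw [hout r hrp, hout s hsp] at hne ⊢
        exact (hA.sparse r hr s hs hne).trans (by gcongr)

/-- Sparse pairs yield families with all gaps opened. -/
theorem HasSparsePairs.exists_openedGaps {R : ℕ → ℕ → Prop} (hR : ∀ x y, R x y → R y x)
    {V : Finset ℕ} {k h d D g s : ℕ} {π : ℕ → ℕ}
    (hπ : Set.BijOn π (Set.Icc 1 (k - 1)) (Set.Icc 1 (k - 1))) {η : ℝ} (hη : 0 ≤ η)
    (hpairs : HasSparsePairs R V η D g s) {A₀ : Finset ℕ} (hA₀ : A₀ ⊆ V) (hthick : Thick h d A₀)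
    (i : ℕ) (hi : i ≤ k - 1) (hd : d + i * (g + 1) ≤ D) (hs : i * s ≤ h) :
    ∃ A h', h ≤ h' + i * s ∧
      OpenedGaps R A₀ k π i A h' (d + i * (g + 1)) ((2 * k) ^ i * η) := by
  have hpairs' : HasSparsePairs R A₀ η D g s := fun A hA => hpairs A (hA.trans hA₀)
  induction i with
  | zero =>
    refine ⟨fun _ => A₀, h, by omega, fun _ => Subset.rfl, fun _ => by simpa using hthick,
      fun _ _ _ => Or.inl rfl, fun _ _ _ => rfl, fun j h1 h2 => by omega,
      fun j l h1 h2 h3 => by omega, fun r _ s _ hne => absurd rfl hne⟩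
  | succ i ih =>
    rw [add_mul, one_mul] at hd hs
    obtain ⟨A, h', hh', hA⟩ := ih (by omega) (by omega) (by omega)
    have hk : (1 : ℝ) ≤ 2 * k := by
      have : (1 : ℝ) ≤ k := by exact_mod_cast (by omega : 1 ≤ k)
      linarith
    obtain ⟨A', h'', hh'', hA'⟩ := hA.step hR hπ hη
      (le_mul_of_one_le_left hη (one_le_pow₀ hk)) hpairs' hi (by omega) (by omega)
    refine ⟨A', h'', by rw [add_mul, one_mul]; omega, ?_⟩
    convert hA' using 1
    · ring
    · ring

theorem OpenedGaps.lt {R : ℕ → ℕ → Prop} {V : Finset ℕ} {k h d : ℕ} {π : ℕ → ℕ}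
    {A : ℕ → Finset ℕ} {η : ℝ} (hπ : Set.BijOn π (Set.Icc 1 (k - 1)) (Set.Icc 1 (k - 1)))
    (hA : OpenedGaps R V k π (k - 1) A h d η) {r s : ℕ} (hr : 1 ≤ r) (hrs : r < s) (hs : s ≤ k) :
    ∀ x ∈ A r, ∀ y ∈ A s, x < y := by
  have hstep : ∀ p, 1 ≤ p → p + 1 ≤ k → ∀ x ∈ A p, ∀ y ∈ A (p + 1), x < y := by
    intro p h1 h2 x hx y hy
    obtain ⟨j, hj, rfl⟩ := hπ.surjOn (⟨h1, by omega⟩ : p ∈ Set.Icc 1 (k - 1))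
    have := hA.opened j hj.1 hj.2 x hx y hy
    have := Nat.two_pow_pos h
    omega
  induction s, hrs using Nat.le_induction with
  | base => exact hstep r hr hs
  | succ s hs' ih =>
    intro x hx y hy
    obtain ⟨z, hz⟩ := (hA.thick s).nonempty
    exact (ih (by omega) x hx z hz).trans (hstep s (by omega) hs z hz y hy)

/-- The choice of a transversal clique from a family with all gaps opened is prevented by
`hclique`; this makes one more color sparse. -/
theorem HasSparsePairs.succ {f : ℕ → ℕ → ℕ} (hf : ∀ x y, f x y = f y x) {V : Finset ℕ}
    {k m e D g s e' : ℕ} {π : ℕ → ℕ} (hk : 2 ≤ k) (hke : k ≤ e)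
    (hπ : Set.BijOn π (Set.Icc 1 (k - 1)) (Set.Icc 1 (k - 1)))
    (hclique : ¬ ∃ a : ℕ → ℕ, (∀ i, 1 ≤ i → i ≤ k → a i ∈ V) ∧
      (∀ i j, 1 ≤ i → i < j → j ≤ k → a i < a j) ∧
      (∀ i j, 1 ≤ i → i < j → j ≤ k → f (a i) (a j) = m) ∧
      ∀ i j, 1 ≤ i → i < j → j ≤ k - 1 → a (π j + 1) - a (π j) < a (π i + 1) - a (π i))
    (he' : k ^ 2 + 2 * k * (e + 1) + (e + 1) ≤ e')
    (hpairs : HasSparsePairs (fun x y => f x y < m) V ((1 / 2) ^ e') D g s) :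
    HasSparsePairs (fun x y => f x y < m + 1) V ((1 / 2) ^ e) D (k * (g + 1 + (e + 1)))
      (k * s) := by
  classical
  intro A₀ hA₀ h d hthick hd hs
  have hk1 : (k - 1) * (g + 1) ≤ k * (g + 1) := Nat.mul_le_mul_right _ (by omega)
  have hks : (k - 1) * s ≤ k * s := Nat.mul_le_mul_right _ (by omega)
  have hsplit : k * (g + 1 + (e + 1)) = k * (g + 1) + (e + 1) * k := by ring
  obtain ⟨A, h', hh', hA⟩ := hpairs.exists_openedGaps (fun x y hxy => by rwa [hf y x]) hπ
    (by positivity) hA₀ hthick (k - 1) le_rfl (by omega) (by omega)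
  have hkM : k ≤ 2 ^ (e + 1) :=
    hke.trans ((Nat.le_succ e).trans Nat.lt_two_pow_self.le)
  rcases exists_transversal_or_sparse (fun x y => f x y = m) (Nat.two_pow_pos (e + 1)) k 1 A hkM
    (fun r _ _ => (hA.thick r).nonempty) with ⟨a, ha, hmono⟩ |
      ⟨r, t, h1, h2, h3, X, hX, Y, hY, h4, h5, h6⟩
  · refine absurd ⟨a, fun i h1 h2 => hA₀ (hA.subset i (ha i h1 (by omega))),
      fun i j h1 h2 h3 => hA.lt hπ h1 h2 h3 _ (ha i h1 (by omega)) _ (ha j (by omega) (by omega)),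
      fun i j h1 h2 h3 => hmono i j h1 h2 (by omega), fun i j h1 h2 h3 => ?_⟩ hclique
    have hi := hπ.mapsTo (⟨h1, by omega⟩ : i ∈ Set.Icc 1 (k - 1))
    have hj := hπ.mapsTo (⟨by omega, h3⟩ : j ∈ Set.Icc 1 (k - 1))
    have e1 : π i + 1 < 1 + k := by have := hi.2; omega
    have e2 : π j + 1 < 1 + k := by have := hj.2; omega
    have m1 := ha (π i) hi.1 (by omega)
    have m2 := ha (π i + 1) (by omega) e1
    have m3 := ha (π j) hj.1 (by omega)
    have m4 := ha (π j + 1) (by omega) e2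
    have e3 := hA.decreasing i j h1 h2 h3 _ m1 _ m2 _ m3 _ m4
    have e4 := hA.lt hπ hi.1 (Nat.lt_succ_self _) (by omega) _ m1 _ m2
    have e5 := hA.lt hπ hj.1 (Nat.lt_succ_self _) (by omega) _ m3 _ m4
    omega
  · have hne : A r ≠ A t := by
      intro heq
      obtain ⟨x, hx⟩ := (hA.thick r).nonempty
      exact absurd (hA.lt hπ h1 h2 (by omega) x hx x (heq ▸ hx)) (lt_irrefl x)
    rw [← pow_mul] at h4 h5
    refine ⟨h', by omega, X, hX.trans (hA.subset r), Y, hY.trans (hA.subset t),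
      ((hA.thick r).of_subset hX h4).mono le_rfl (by omega),
      ((hA.thick t).of_subset hY h5).mono le_rfl (by omega),
      ((hA.separated r t h2).resolve_left hne).mono le_rfl hX hY, ?_⟩
    have hsp := hA.sparse r (Finset.mem_Icc.mpr ⟨h1, by omega⟩) t
      (Finset.mem_Icc.mpr ⟨by omega, by omega⟩) hne
    have hsum : pairCount (fun x y => f x y < m + 1) X Y
        ≤ pairCount (fun x y => f x y < m) X Y + pairCount (fun x y => f x y = m) X Y := by
      unfold pairCount
      rw [← sum_add_distrib]
      refine sum_le_sum fun x _ => ?_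
      refine (card_le_card ?_).trans (card_union_le _ _)
      intro y hy
      simp only [mem_union, mem_filter] at hy ⊢
      rcases Nat.lt_succ_iff_lt_or_eq.mp hy.2 with h | h
      · exact Or.inl ⟨hy.1, h⟩
      · exact Or.inr ⟨hy.1, h⟩
    have hold : (pairCount (fun x y => f x y < m) X Y : ℝ) ≤ (1 / 2) ^ (e + 1) * #X * #Y := by
      have c1 : (#(A r) : ℝ) ≤ 2 ^ ((e + 1) * k) * #X := by exact_mod_cast h4
      have c2 : (#(A t) : ℝ) ≤ 2 ^ ((e + 1) * k) * #Y := by exact_mod_cast h5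
      have c3 : ((2 * k : ℝ)) ^ (k - 1) ≤ 2 ^ (k ^ 2) := by
        have hkk : 2 * k ≤ 2 ^ k := by
          obtain ⟨n, rfl⟩ := Nat.exists_eq_add_of_le hk
          have : n + 1 ≤ 2 ^ n := Nat.lt_two_pow_self
          rw [pow_add]
          omega
        have : (2 * k) ^ (k - 1) ≤ 2 ^ (k ^ 2) := by
          calc (2 * k) ^ (k - 1) ≤ (2 ^ k) ^ (k - 1) := Nat.pow_le_pow_left hkk _
            _ ≤ (2 ^ k) ^ k := Nat.pow_le_pow_right (Nat.two_pow_pos k) (by omega)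
            _ = _ := by rw [← pow_mul, sq]
        exact_mod_cast this
      have c4 : (2 : ℝ) ^ (k ^ 2) * (1 / 2) ^ e' * 2 ^ ((e + 1) * k) * 2 ^ ((e + 1) * k)
          ≤ (1 / 2) ^ (e + 1) := by
        obtain ⟨u, rfl⟩ := Nat.exists_eq_add_of_le he'
        have : (2 : ℝ) ^ (k ^ 2) * (1 / 2) ^ (k ^ 2 + 2 * k * (e + 1) + (e + 1) + u)
            * 2 ^ ((e + 1) * k) * 2 ^ ((e + 1) * k)
            = (1 / 2) ^ (e + 1) * (1 / 2) ^ u *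
              ((2 : ℝ) ^ (k ^ 2 + 2 * k * (e + 1)) * (1 / 2) ^ (k ^ 2 + 2 * k * (e + 1))) := by
          ring
        rw [this, ← mul_pow, mul_one_div_cancel two_ne_zero, one_pow, mul_one]
        exact mul_le_of_le_one_right (by positivity) (pow_le_one₀ (by norm_num) (by norm_num))
      calc (pairCount (fun x y => f x y < m) X Y : ℝ)
          ≤ pairCount (fun x y => f x y < m) (A r) (A t) := by
            exact_mod_cast pairCount_mono _ hX hY
        _ ≤ (2 * k) ^ (k - 1) * (1 / 2) ^ e' * #(A r) * #(A t) := hsp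
        _ ≤ 2 ^ (k ^ 2) * (1 / 2) ^ e' * (2 ^ ((e + 1) * k) * #X) * (2 ^ ((e + 1) * k) * #Y) := by
            gcongr
        _ = (2 ^ (k ^ 2) * (1 / 2) ^ e' * 2 ^ ((e + 1) * k) * 2 ^ ((e + 1) * k)) * #X * #Y := by
            ring
        _ ≤ _ := by gcongr
    have hnew : (pairCount (fun x y => f x y = m) X Y : ℝ) ≤ (1 / 2) ^ (e + 1) * #X * #Y := by
      have h6' : (2 : ℝ) ^ (e + 1) * pairCount (fun x y => f x y = m) X Y ≤ #X * #Y := by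
        exact_mod_cast h6
      rw [one_div, inv_pow, mul_assoc, ← div_eq_inv_mul, le_div_iff₀' (by positivity)]
      exact h6'
    calc (pairCount (fun x y => f x y < m + 1) X Y : ℝ)
        ≤ pairCount (fun x y => f x y < m) X Y + pairCount (fun x y => f x y = m) X Y := by
          exact_mod_cast hsum
      _ ≤ (1 / 2) ^ (e + 1) * #X * #Y + (1 / 2) ^ (e + 1) * #X * #Y := add_le_add hold hnew
      _ = (1 / 2) ^ e * #X * #Y := by ring

theorem HasSparsePairs.mono {R : ℕ → ℕ → Prop} {V : Finset ℕ} {η : ℝ} {D g g' s : ℕ}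
    (H : HasSparsePairs R V η D g s) (hg : g ≤ g') : HasSparsePairs R V η D g' s := by
  intro A hA h d hthick hd hs
  obtain ⟨h', hh', X, hX, Y, hY, h1, h2, h3⟩ := H A hA h d hthick (by omega) hs
  exact ⟨h', hh', X, hX, Y, hY, h1.mono le_rfl (by omega), h2.mono le_rfl (by omega), h3⟩

/-- If no color below `q` contains a clique of the prescribed type, then the first `m ≤ q` colors
are simultaneously sparse between suitable thick sets. -/
theorem hasSparsePairs_of_no_clique {f : ℕ → ℕ → ℕ} (hf : ∀ x y, f x y = f y x) {V : Finset ℕ}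
    {k q D : ℕ} {π : ℕ → ℕ} (hk : 2 ≤ k)
    (hπ : Set.BijOn π (Set.Icc 1 (k - 1)) (Set.Icc 1 (k - 1)))
    (hclique : ∀ m < q, ¬ ∃ a : ℕ → ℕ, (∀ i, 1 ≤ i → i ≤ k → a i ∈ V) ∧
      (∀ i j, 1 ≤ i → i < j → j ≤ k → a i < a j) ∧
      (∀ i j, 1 ≤ i → i < j → j ≤ k → f (a i) (a j) = m) ∧
      ∀ i j, 1 ≤ i → i < j → j ≤ k - 1 → a (π j + 1) - a (π j) < a (π i + 1) - a (π i))
    (m : ℕ) (hm : m ≤ q) (e : ℕ) (hke : k ≤ e) :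
    HasSparsePairs (fun x y => f x y < m) V ((1 / 2) ^ e) D (e * k ^ (7 * m))
      (k ^ m * (D + 3)) := by
  induction m generalizing e with
  | zero =>
    intro A _ h d hA hd hs
    simp only [mul_zero, pow_zero, mul_one, one_mul] at hd hs ⊢
    obtain ⟨h', hh', X, hX, Y, hY, h1, h2, h3⟩ := hA.exists_farBelow (by omega)
    refine ⟨h', by omega, X, hX, Y, hY, h1.mono le_rfl (by omega), h2.mono le_rfl (by omega), h3, ?_⟩
    have : pairCount (fun x y => f x y < 0) X Y = 0 := by simp [pairCount]
    rw [this, Nat.cast_zero]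
    positivity
  | succ m ih =>
    have hk4 : 4 * k ^ 2 ≤ k ^ 4 := by
      calc 4 * k ^ 2 = 2 ^ 2 * k ^ 2 := by norm_num
        _ ≤ k ^ 2 * k ^ 2 := Nat.mul_le_mul_right _ (Nat.pow_le_pow_left hk 2)
        _ = k ^ 4 := by ring
    have hke4 : k ^ 2 + 2 * k * (e + 1) + (e + 1) ≤ k ^ 4 * e := by
      have h1 : 4 * k ^ 2 * e ≤ k ^ 4 * e := Nat.mul_le_mul_right _ hk4
      have h2 : 2 * (k * e) ≤ k ^ 2 * e := by nlinarith [Nat.zero_le (k * e)]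
      have h3 : k ^ 2 ≤ k * e := by nlinarith
      have h4 : 2 * e ≤ k * e := Nat.mul_le_mul_right _ hk
      nlinarith
    have hmain := (ih (by omega) (k ^ 4 * e) (by nlinarith)).succ hf hk hke hπ
      (hclique m (by omega)) hke4
    have hs : k * (k ^ m * (D + 3)) = k ^ (m + 1) * (D + 3) := by ring
    rw [hs] at hmain
    refine hmain.mono ?_
    have hK : 1 ≤ k ^ (7 * m) := Nat.one_le_pow _ _ (by omega)
    have he : e ≤ e * k ^ (7 * m) := Nat.le_mul_of_pos_right _ hK
    calc k * (k ^ 4 * e * k ^ (7 * m) + 1 + (e + 1))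
        ≤ k * (k ^ 4 * (e * k ^ (7 * m)) + 2 * (e * k ^ (7 * m))) := by
          refine Nat.mul_le_mul_left _ ?_
          rw [mul_assoc]
          omega
      _ = (k * (k ^ 4 + 2)) * (e * k ^ (7 * m)) := by ring
      _ ≤ k ^ 7 * (e * k ^ (7 * m)) := by
          refine Nat.mul_le_mul_right _ ?_
          have : k ^ 4 + 2 ≤ k ^ 6 := by nlinarith
          calc k * (k ^ 4 + 2) ≤ k * k ^ 6 := Nat.mul_le_mul_left _ this
            _ = k ^ 7 := by ring
      _ = e * k ^ (7 * (m + 1)) := by ring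

/-- Theorem 1.2 / Theorem 4.5.
Let `k, q ≥ 2` and let `π` be a permutation of `{1, ..., k-1}`. Every `q`-coloring of the
edges of the complete graph on `{1, ..., n}` with `n = 2 ^ (k ^ (20q))` contains a
monochromatic clique `a₁ < ... < a_k` whose consecutive differences satisfy
`a_{π(1)+1} - a_{π(1)} > a_{π(2)+1} - a_{π(2)} > ... > a_{π(k-1)+1} - a_{π(k-1)}`. -/
theorem ramsey_with_order_type (k q : ℕ) (hk : 2 ≤ k) (hq : 2 ≤ q)
    (π : ℕ → ℕ) (hπ : Set.BijOn π (Set.Icc 1 (k - 1)) (Set.Icc 1 (k - 1)))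
    (c : ℕ → ℕ → Fin q) :
    ∃ a : ℕ → ℕ,
      (∀ i, 1 ≤ i → i ≤ k → a i ∈ Finset.Icc 1 (2 ^ k ^ (20 * q))) ∧
      (∀ i j, 1 ≤ i → i < j → j ≤ k → a i < a j) ∧
      (∃ clr : Fin q, ∀ i j, 1 ≤ i → i < j → j ≤ k → c (a i) (a j) = clr) ∧
      (∀ i j, 1 ≤ i → i < j → j ≤ k - 1 →
        a (π j + 1) - a (π j) < a (π i + 1) - a (π i)) := by

  by_contra hno
  set N := k ^ (20 * q) with hN
  set f : ℕ → ℕ → ℕ := fun x y => (c (min x y) (max x y) : ℕ) with hf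
  have hfs : ∀ x y, f x y = f y x := fun x y => by simp only [hf, min_comm, max_comm]
  set D := k * k ^ (7 * q) with hD
  have hpairs := hasSparsePairs_of_no_clique (V := Finset.Icc 1 (2 ^ N)) (q := q) (D := D) hfs hk hπ
    (by
      rintro m hm ⟨a, h1, h2, h3, h4⟩
      refine hno ⟨a, h1, h2, ⟨⟨m, hm⟩, fun i j hi hij hj => ?_⟩, h4⟩
      have h5 := h3 i j hi hij hj
      have h6 := (h2 i j hi hij hj).le
      simp only [hf, min_eq_left h6, max_eq_right h6] at h5
      exact Fin.ext h5) q le_rfl k le_rfl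
  have hscale : k ^ q * (D + 3) + 1 ≤ N := by
    have hD2 : 1 ≤ D := Nat.mul_pos (by omega) (Nat.pow_pos (by omega))
    have hq1 : 1 ≤ k ^ q := Nat.one_le_pow _ _ (by omega)
    calc k ^ q * (D + 3) + 1 ≤ k ^ q * (8 * D) := by nlinarith
      _ = 2 ^ 3 * (k ^ q * D) := by ring
      _ ≤ k ^ 3 * (k ^ q * D) := Nat.mul_le_mul_right _ (Nat.pow_le_pow_left hk 3)
      _ = k ^ (8 * q + 4) := by rw [hD]; ring
      _ ≤ N := Nat.pow_le_pow_right (by omega) (by omega)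
  obtain ⟨n, hn⟩ : ∃ n, N = n + 1 := ⟨N - 1, by omega⟩
  have hpow : 2 ^ N = 2 * 2 ^ n := by rw [hn, pow_succ, mul_comm]
  have hpos := Nat.two_pow_pos n
  obtain ⟨h', -, X, -, Y, -, hX, hY, -, hXY⟩ := hpairs (Finset.Ico (2 ^ n) (2 * 2 ^ n))
    (fun x hx => by
      rw [Finset.mem_Ico] at hx
      rw [Finset.mem_Icc]
      omega) n 0
    ⟨n, le_rfl, ⟨1, fun x hx => by
      rw [Finset.mem_Ico] at hx
      exact Nat.div_eq_of_lt_le (by omega) (by omega)⟩, by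
      rw [Nat.card_Ico]
      omega⟩ (by omega) (by omega)
  have hfull : pairCount (fun x y => f x y < q) X Y = #X * #Y := by
    simp [pairCount, hf]
  rw [hfull] at hXY
  have hXp : (0 : ℝ) < #X := by exact_mod_cast hX.card_pos
  have hYp : (0 : ℝ) < #Y := by exact_mod_cast hY.card_pos
  have hhalf : ((1 : ℝ) / 2) ^ k < 1 := pow_lt_one₀ (by norm_num) (by norm_num) (by omega)
  push_cast at hXY
  rw [mul_assoc] at hXY
  nlinarith [mul_pos hXp hYp]
end

section
/- Suppose 0 < a ≤ 1/4 is a real number. Then every 2-coloring (red/blue) of the edges of the complete graph on n vertices contains either a red clique of order at least a·ln n or a blue clique of order at least e^(1/(4a))·ln n. -/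
/-- The Erdős–Szekeres bound, for the coloring of pairs read off with the smaller vertex first. -/
theorem exists_clique_of_choose_le_card {α : Type*} [LinearOrder α] (c : α → α → Bool) (k m : ℕ)
    (S : Finset α) (hS : (k + m).choose k ≤ S.card) :
    (∃ K ⊆ S, (∀ i ∈ K, ∀ j ∈ K, i < j → c i j = true) ∧ K.card = k + 1) ∨
    (∃ L ⊆ S, (∀ i ∈ L, ∀ j ∈ L, i < j → c i j = false) ∧ L.card = m + 1) := by
  induction hN : k + m using Nat.strong_induction_on generalizing k m S with
  | _ N ih =>
  have hne : S.Nonempty :=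
    Finset.card_pos.mp ((Nat.choose_pos (Nat.le_add_right k m)).trans_le hS)
  obtain ⟨v, hv, hmin⟩ : ∃ v ∈ S, ∀ w ∈ S, v ≤ w := ⟨S.min' hne, S.min'_mem hne, S.min'_le⟩
  -- Adjoining the minimum `v` to a clique inside one of its neighborhoods.
  have extend : ∀ (b : Bool) (T : Finset α), T ⊆ {w ∈ S.erase v | c v w = b} →
      (∀ i ∈ T, ∀ j ∈ T, i < j → c i j = b) →
      insert v T ⊆ S ∧ (∀ i ∈ insert v T, ∀ j ∈ insert v T, i < j → c i j = b) ∧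
        (insert v T).card = T.card + 1 := by
    intro b T hT hc
    have hT' : ∀ w ∈ T, w ∈ S ∧ w ≠ v ∧ c v w = b := by
      intro w hw
      have := hT hw
      simp only [Finset.mem_filter, Finset.mem_erase] at this
      exact ⟨this.1.2, this.1.1, this.2⟩
    refine ⟨Finset.insert_subset hv fun w hw => (hT' w hw).1, ?_,
      Finset.card_insert_of_notMem fun h => (hT' v h).2.1 rfl⟩
    intro i hi j hj hij
    rcases Finset.mem_insert.mp hj with rfl | hjT
    · have hi' : i ∈ S := (Finset.mem_insert.mp hi).elim (· ▸ hv) fun h => (hT' i h).1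
      exact absurd hij (hmin i hi').not_gt
    · rcases Finset.mem_insert.mp hi with rfl | hiT
      · exact (hT' j hjT).2.2
      · exact hc i hiT j hjT hij
  rcases k with _ | k
  · exact .inl ⟨{v}, by simpa using hv, by simp, by simp⟩
  rcases m with _ | m
  · exact .inr ⟨{v}, by simpa using hv, by simp, by simp⟩
  have hcard : ({w ∈ S.erase v | c v w = true}).card + ({w ∈ S.erase v | c v w = false}).card + 1
      = S.card := by
    rw [← Finset.card_erase_add_one hv,
      ← Finset.card_filter_add_card_filter_not (s := S.erase v) (fun w => c v w = true)]
    simp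
  have hchoose : (k + 1 + (m + 1)).choose (k + 1)
      = (k + (m + 1)).choose k + (k + 1 + m).choose (k + 1) := by
    rw [show k + 1 + (m + 1) = (k + (m + 1)) + 1 by ring, Nat.choose_succ_succ,
      show k + (m + 1) = k + 1 + m by ring]
  have hsub : ∀ b : Bool, {w ∈ S.erase v | c v w = b} ⊆ S := fun b =>
    (Finset.filter_subset _ _).trans (Finset.erase_subset _ _)
  rcases le_or_gt ((k + (m + 1)).choose k) ({w ∈ S.erase v | c v w = true}).card with h | h
  · rcases ih _ (by lia) k (m + 1) _ h rfl with ⟨K, hK, hc, hk⟩ | ⟨L, hL, hc, hl⟩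
    · obtain ⟨h₁, h₂, h₃⟩ := extend true K hK hc
      exact .inl ⟨_, h₁, h₂, by rw [h₃, hk]⟩
    · exact .inr ⟨L, hL.trans (hsub _), hc, hl⟩
  · rcases ih _ (by lia) (k + 1) m {w ∈ S.erase v | c v w = false} (by lia) rfl with
      ⟨K, hK, hc, hk⟩ | ⟨L, hL, hc, hl⟩
    · exact .inl ⟨K, hK.trans (hsub _), hc, hk⟩
    · obtain ⟨h₁, h₂, h₃⟩ := extend false L hL hc
      exact .inr ⟨_, h₁, h₂, by rw [h₃, hl]⟩

theorem choose_le_exp (k m : ℕ) (t : ℝ) :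
    ((k + m).choose k : ℝ) ≤ Real.exp ((k + m) * Real.exp (-t) + k * t) := by
  have h : Real.exp (-t) ^ k * ((k + m).choose k : ℝ) ≤ (Real.exp (-t) + 1) ^ (k + m) := by
    rw [add_pow]
    simpa using Finset.single_le_sum
      (f := fun i => Real.exp (-t) ^ i * 1 ^ (k + m - i) * ((k + m).choose i : ℝ))
      (fun i _ => by positivity) (Finset.mem_range.mpr (by lia : k < k + m + 1))
  have h' : (Real.exp (-t) + 1) ^ (k + m) ≤ Real.exp ((k + m) * Real.exp (-t)) := by
    calc _ ≤ Real.exp (Real.exp (-t)) ^ (k + m) :=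
          pow_le_pow_left₀ (by positivity) (Real.add_one_le_exp _) _
      _ = _ := by rw [← Real.exp_nat_mul]; push_cast; rfl
  rw [Real.exp_add, Real.exp_nat_mul t]
  calc ((k + m).choose k : ℝ)
      = (Real.exp (-t) ^ k * ((k + m).choose k : ℝ)) * Real.exp t ^ k := by
        rw [Real.exp_neg, inv_pow]; field_simp
    _ ≤ _ := by gcongr; exact h.trans h'

theorem skewed_exponent_le_one {a : ℝ} (ha : 0 < a) (ha' : a ≤ 1 / 4) :
    (a + Real.exp (1 / (4 * a))) * Real.exp (-(1 / (4 * a) - Real.log a))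
      + a * (1 / (4 * a) - Real.log a) ≤ 1 := by
  have hz : Real.exp (-(1 / (4 * a) - Real.log a)) = a * (Real.exp (1 / (4 * a)))⁻¹ := by
    rw [neg_sub, Real.exp_sub, Real.exp_log ha, div_eq_mul_inv]
  have hb : 1 ≤ Real.exp (1 / (4 * a)) := Real.one_le_exp (by positivity)
  have hbinv : (Real.exp (1 / (4 * a)))⁻¹ ≤ 1 := inv_le_one_of_one_le₀ hb
  have hlog : -Real.log a ≤ 1 / (2 * a) - 1 + Real.log 2 := by
    have h := Real.log_le_sub_one_of_pos (show 0 < 1 / (2 * a) by positivity)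
    rw [one_div, Real.log_inv, Real.log_mul two_ne_zero ha.ne'] at h
    rw [one_div]
    linarith
  have h₁ : a * -Real.log a ≤ 1 / 2 - a + a * Real.log 2 := by
    calc _ ≤ a * (1 / (2 * a) - 1 + Real.log 2) := by gcongr
      _ = _ := by field_simp
  have h₂ : a * Real.log 2 ≤ 1 / 4 * 0.7 := by
    have := Real.log_two_lt_d9
    gcongr
    linarith
  have h₃ : a * (a * (Real.exp (1 / (4 * a)))⁻¹) ≤ 1 / 4 * (1 / 4 * 1) := by gcongr
  have h₄ : Real.exp (1 / (4 * a)) * (a * (Real.exp (1 / (4 * a)))⁻¹) = a := by field_simp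
  have h₅ : a * (1 / (4 * a)) = 1 / 4 := by field_simp
  rw [hz, add_mul, h₄, mul_sub, h₅]
  linarith

/-- Lemma 3.1.
For `0 < a ≤ 1/4`, every red/blue coloring of the edges of the complete graph on `n`
vertices contains either a red clique of order at least `a · ln n` or a blue clique of
order at least `e^(1/(4a)) · ln n`. -/
theorem skewed_erdos_szekeres (a : ℝ) (ha : 0 < a) (ha' : a ≤ 1 / 4)
    (n : ℕ) (c : Fin n → Fin n → Bool) :
    (∃ K : Finset (Fin n), (∀ i ∈ K, ∀ j ∈ K, i < j → c i j = true) ∧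
      a * Real.log n ≤ (K.card : ℝ)) ∨
    (∃ L : Finset (Fin n), (∀ i ∈ L, ∀ j ∈ L, i < j → c i j = false) ∧
      Real.exp (1 / (4 * a)) * Real.log n ≤ (L.card : ℝ)) := by
  rcases le_or_gt n 1 with hn | hn
  · exact .inl ⟨∅, by simp, by interval_cases n <;> simp⟩
  have hlog : 0 < Real.log n := Real.log_pos (by exact_mod_cast hn)
  have exists_pred : ∀ x : ℝ, 0 < x → ∃ k : ℕ, (k : ℝ) ≤ x ∧ x ≤ ((k + 1 : ℕ) : ℝ) := fun x hx =>
    ⟨⌊x⌋₊, Nat.floor_le hx.le, by exact_mod_cast (Nat.lt_floor_add_one x).le⟩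
  obtain ⟨k, hk, hk'⟩ := exists_pred (a * Real.log n) (by positivity)
  obtain ⟨m, hm, hm'⟩ := exists_pred (Real.exp (1 / (4 * a)) * Real.log n) (by positivity)
  have ht : 0 ≤ 1 / (4 * a) - Real.log a :=
    sub_nonneg.mpr ((Real.log_nonpos ha.le (by linarith)).trans (by positivity))
  have hchoose : (k + m).choose k ≤ n := by
    have : ((k + m).choose k : ℝ) ≤ n := by
      refine (choose_le_exp k m (1 / (4 * a) - Real.log a)).trans ?_
      rw [← Real.le_log_iff_exp_le (by positivity)]
      calc _ ≤ (a * Real.log n + Real.exp (1 / (4 * a)) * Real.log n)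
              * Real.exp (-(1 / (4 * a) - Real.log a))
            + a * Real.log n * (1 / (4 * a) - Real.log a) := by gcongr
        _ = ((a + Real.exp (1 / (4 * a))) * Real.exp (-(1 / (4 * a) - Real.log a))
            + a * (1 / (4 * a) - Real.log a)) * Real.log n := by ring
        _ ≤ 1 * Real.log n := by gcongr; exact skewed_exponent_le_one ha ha'
        _ = Real.log n := one_mul _
    exact_mod_cast this
  rcases exists_clique_of_choose_le_card c k m Finset.univ (by simpa using hchoose) with
    ⟨K, -, hK, hcard⟩ | ⟨L, -, hL, hcard⟩
  · exact .inl ⟨K, hK, by rwa [hcard]⟩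
  · exact .inr ⟨L, hL, by rwa [hcard]⟩
end

section
/- Suppose G is a graph on a finite subset of the integers, J is an interval of integers, S ⊆ J ∩ V(G) is nonempty, φ: {1,...,h-1} → {1,...,k-1} is an injective function, 0 < α, β, γ, δ, η, p < 1 are reals, and r is a positive integer. Let t = 2·√(k·log_{1/p}|S|), ε = p^t/2, λ = (εα/4)^(2h), and κ = λ·β·d_J(S)²·η^k·r. If κ ≥ h, |J| ≥ r, η ≤ β·λ·d_J(S)², δ ≤ λ, γ·|S| ≤ κ, and G is (α, β, γ, δ, p)-heavy with respect to S, then G contains a clique of type (φ, η, r). -/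
/-- An ordered pair `(T₁, T₂)` of (nonempty, finite) sets of integers is *separated* if,
for `j = 1, 2`, `min(T₂) - max(T₁) > max(T_j) - min(T_j)`. -/
def Separated (T₁ T₂ : Finset ℤ) : Prop :=
  ∃ h₁ : T₁.Nonempty, ∃ h₂ : T₂.Nonempty,
    T₁.max' h₁ - T₁.min' h₁ < T₂.min' h₂ - T₁.max' h₁ ∧
    T₂.max' h₂ - T₂.min' h₂ < T₂.min' h₂ - T₁.max' h₁

/-- The density `d_I(S) = |S| / |I|` of a finite set `S` of integers with respect to a
finite set (interval) `I` containing it. -/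
noncomputable def dens (I S : Finset ℤ) : ℝ := (S.card : ℝ) / (I.card : ℝ)

/-- A graph `G` on a subset of the integers is `(α, β, γ, δ, p)`-*heavy* with respect to
`S ⊆ J = [a, b]` if every subset `S' ⊆ S` with `|S'| ≥ γ|S|`, contained in an interval
`J'` with `d_{J'}(S') ≥ δ d_J(S)`, contains a separated pair `(T₁, T₂)` of subsets,
lying in intervals `I₁, I₂` with `d_{I_j}(T_j) ≥ α d_{J'}(S')` and `|I_j| ≥ β |S'|`,
such that the edge density of `G` between `T₁` and `T₂` is at least `p`. -/
def Heavy (G : SimpleGraph ℤ) [DecidableRel G.Adj] (a b : ℤ) (S : Finset ℤ)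
    (α β γ δ p : ℝ) : Prop :=
  ∀ S' : Finset ℤ, S' ⊆ S → γ * (S.card : ℝ) ≤ (S'.card : ℝ) →
    ∀ a' b' : ℤ, S' ⊆ Finset.Icc a' b' →
      δ * dens (Finset.Icc a b) S ≤ dens (Finset.Icc a' b') S' →
      ∃ (T₁ T₂ : Finset ℤ) (a₁ b₁ a₂ b₂ : ℤ),
        T₁ ⊆ S' ∧ T₂ ⊆ S' ∧
        T₁ ⊆ Finset.Icc a₁ b₁ ∧ T₂ ⊆ Finset.Icc a₂ b₂ ∧
        Separated T₁ T₂ ∧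
        α * dens (Finset.Icc a' b') S' ≤ dens (Finset.Icc a₁ b₁) T₁ ∧
        α * dens (Finset.Icc a' b') S' ≤ dens (Finset.Icc a₂ b₂) T₂ ∧
        β * (S'.card : ℝ) ≤ ((Finset.Icc a₁ b₁).card : ℝ) ∧
        β * (S'.card : ℝ) ≤ ((Finset.Icc a₂ b₂).card : ℝ) ∧
        p ≤ (G.edgeDensity T₁ T₂ : ℝ)

/-- A clique in `G` of type `(φ, η, r)` (for `φ : {1,...,h-1} → {1,...,k-1}` injective)
consists of `h` pairwise adjacent vertices `a₁ < ... < a_h` with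
`a_{i+1} - a_i ∈ [η^{φ(i)} r, η^{φ(i)-1} r)` for each `i ∈ {1,...,h-1}`. -/
def CliqueOfType (G : SimpleGraph ℤ) (h : ℕ) (φ : ℕ → ℕ) (η : ℝ) (r : ℕ) : Prop :=
  ∃ a : ℕ → ℤ,
    (∀ i j, 1 ≤ i → i < j → j ≤ h → a i < a j ∧ G.Adj (a i) (a j)) ∧
    (∀ i, 1 ≤ i → i ≤ h - 1 →
      η ^ (φ i) * (r : ℝ) ≤ ((a (i + 1) - a i : ℤ) : ℝ) ∧
      ((a (i + 1) - a i : ℤ) : ℝ) < η ^ (φ i - 1) * (r : ℝ))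

open Finset in
/-- Among consecutive blocks of length `L` covering an interval, one meets `S` with at least half
of the density of `S` in that interval. -/
lemma exists_dense_subinterval {S : Finset ℤ} {a b : ℤ} (hS : S ⊆ Icc a b) {L : ℕ} (hL : 0 < L)
    (hLI : L ≤ #(Icc a b)) :
    ∃ (T : Finset ℤ) (c : ℤ), T ⊆ S ∧ T ⊆ Icc c (c + L - 1) ∧
      dens (Icc a b) S / 2 ≤ dens (Icc c (c + L - 1)) T := by
  set N := #(Icc a b) with hN
  have hLz : (0 : ℤ) < L := by exact_mod_cast hL
  have hNab : (N : ℤ) = b + 1 - a := by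
    have : 0 < N := by omega
    rw [hN, Int.card_Icc] at this ⊢
    omega
  have hmaps : ∀ x ∈ S, (x - a) / (L : ℤ) ∈ Icc (0 : ℤ) ((N / L : ℕ) : ℤ) := by
    intro x hx
    have := mem_Icc.1 (hS hx)
    rw [mem_Icc]
    refine ⟨Int.ediv_nonneg (by omega) hLz.le, ?_⟩
    push_cast
    exact Int.ediv_le_ediv hLz (by omega)
  by_contra! hcon
  have hcard := card_eq_sum_card_fiberwise hmaps
  have hNpos : (0 : ℝ) < N := by exact_mod_cast (by omega : 0 < N)
  have hLpos : (0 : ℝ) < L := by exact_mod_cast hL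
  have hlt : ∀ j ∈ Icc (0 : ℤ) ((N / L : ℕ) : ℤ),
      (#{x ∈ S | (x - a) / (L : ℤ) = j} : ℝ) < #S / N / 2 * L := by
    intro j _
    have h1 := hcon {x ∈ S | (x - a) / (L : ℤ) = j} (a + L * j) (filter_subset _ _) (by
      intro x hx
      obtain ⟨-, hx⟩ := mem_filter.1 hx
      have h2 := Int.mul_ediv_add_emod (x - a) L
      have h3 := Int.emod_nonneg (x - a) hLz.ne'
      have h4 := Int.emod_lt_of_pos (x - a) hLz
      rw [hx] at h2
      rw [mem_Icc]
      constructor <;> linarith)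
    have h5 : #(Icc (a + L * j) (a + L * j + L - 1)) = L := by
      rw [Int.card_Icc]; omega
    rw [_root_.dens, _root_.dens, h5, div_lt_iff₀ hLpos] at h1
    exact h1
  have hsum := sum_lt_sum_of_nonempty (s := Icc (0 : ℤ) ((N / L : ℕ) : ℤ)) ⟨0, mem_Icc.2 ⟨le_rfl, Int.natCast_nonneg _⟩⟩ hlt
  rw [← Nat.cast_sum, ← hcard, sum_const, Int.card_Icc, nsmul_eq_mul] at hsum
  have hM : (((N / L : ℕ) : ℤ) + 1 - 0).toNat = N / L + 1 := by
    generalize N / L = m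
    omega
  have hML : (N / L + 1) * L ≤ 2 * N := by
    have := Nat.div_mul_le_self N L
    nlinarith
  have hML' : ((N / L + 1 : ℕ) : ℝ) * L ≤ 2 * N := by exact_mod_cast hML
  rw [hM] at hsum
  have h6 : ((N / L + 1 : ℕ) : ℝ) * (#S / N / 2 * L) ≤ #S := by
    calc ((N / L + 1 : ℕ) : ℝ) * (#S / N / 2 * L)
        = (#S / N / 2) * (((N / L + 1 : ℕ) : ℝ) * L) := by ring
      _ ≤ (#S / N / 2) * (2 * N) := by gcongr
      _ = #S := by field_simp
  linarith

open Finset in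
lemma card_interedges_eq_sum (G : SimpleGraph ℤ) [DecidableRel G.Adj] (A B : Finset ℤ) :
    #(G.interedges A B) = ∑ v ∈ B, #{x ∈ A | G.Adj x v} := by
  rw [SimpleGraph.interedges, Rel.interedges, card_filter, sum_product_right]
  exact sum_congr rfl fun v _ => (card_filter _ _).symm

open Finset in
/-- Dependent random choice: a pair of density at least `p` contains a large subset `U` of the
second part each of whose `q`-tuples has many common neighbours in the first part. -/
lemma dependent_random_choice (G : SimpleGraph ℤ) [DecidableRel G.Adj] {A B : Finset ℤ}
    (hA : A.Nonempty) (hB : B.Nonempty) {p ε : ℝ} (hp : 0 < p) (hε : 0 < ε)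
    (hpd : p ≤ (G.edgeDensity A B : ℝ)) (q s : ℕ)
    (hs : (#B : ℝ) ^ q * ε ^ s ≤ p ^ s - ε) :
    ∃ U ⊆ B, ε * #B ≤ #U ∧ ∀ f : Fin q → ℤ, (∀ j, f j ∈ U) →
      ε * #A ≤ #{x ∈ A | ∀ j, G.Adj x (f j)} := by
  have hA0 : (0 : ℝ) < #A := by exact_mod_cast hA.card_pos
  have hB0 : (0 : ℝ) < #B := by exact_mod_cast hB.card_pos
  let Ω : Finset (Fin s → ℤ) := Fintype.piFinset fun _ => A
  let U : (Fin s → ℤ) → Finset ℤ := fun x => {v ∈ B | ∀ i, G.Adj (x i) v}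
  let N : (Fin q → ℤ) → Finset ℤ := fun f => {x ∈ A | ∀ j, G.Adj x (f j)}
  let bad : Finset (Fin q → ℤ) :=
    {f ∈ Fintype.piFinset fun _ => B | (#(N f) : ℝ) < ε * #A}
  let badIn : (Fin s → ℤ) → Finset (Fin q → ℤ) := fun x =>
    {f ∈ bad | ∀ i j, G.Adj (x i) (f j)}
  have hΩ : Ω.Nonempty := Fintype.piFinset_nonempty.2 fun _ => hA
  have hΩcard : (#Ω : ℝ) = (#A : ℝ) ^ s := by simp [Ω, Fintype.card_piFinset]
  have hUsum : ∑ x ∈ Ω, #(U x) = ∑ v ∈ B, #{x ∈ A | G.Adj x v} ^ s := by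
    refine (sum_card_bipartiteAbove_eq_sum_card_bipartiteBelow
      fun (x : Fin s → ℤ) v => ∀ i, G.Adj (x i) v).trans (sum_congr rfl fun v _ => ?_)
    have : {x ∈ Ω | ∀ i, G.Adj (x i) v} = Fintype.piFinset fun _ => {x ∈ A | G.Adj x v} := by
      ext x; simp [Ω, forall_and]
    rw [bipartiteBelow, this, Fintype.card_piFinset]; simp
  have hbadsum : ∑ x ∈ Ω, #(badIn x) = ∑ f ∈ bad, #(N f) ^ s := by
    refine (sum_card_bipartiteAbove_eq_sum_card_bipartiteBelow
      fun (x : Fin s → ℤ) (f : Fin q → ℤ) => ∀ i j, G.Adj (x i) (f j)).trans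
      (sum_congr rfl fun f _ => ?_)
    have : {x ∈ Ω | ∀ i j, G.Adj (x i) (f j)} = Fintype.piFinset fun _ => N f := by
      ext x; simp [Ω, N, forall_and]
    rw [bipartiteBelow, this, Fintype.card_piFinset]; simp
  have hbadle : (∑ x ∈ Ω, (#(badIn x) : ℝ)) ≤ (#B : ℝ) ^ q * (ε * #A) ^ s := by
    rw [← Nat.cast_sum, hbadsum, Nat.cast_sum]
    calc ∑ f ∈ bad, ((#(N f) ^ s : ℕ) : ℝ) ≤ ∑ f ∈ bad, (ε * #A) ^ s := by
          refine sum_le_sum fun f hf => ?_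
          push_cast
          have := (mem_filter.1 hf).2
          gcongr
      _ = #bad * (ε * #A) ^ s := by rw [sum_const, nsmul_eq_mul]
      _ ≤ (#B : ℝ) ^ q * (ε * #A) ^ s := by
          gcongr
          have : #bad ≤ #B ^ q := by
            refine (card_filter_le _ _).trans ?_
            simp [Fintype.card_piFinset]
          exact_mod_cast this
  have hdeg : p * #A * #B ≤ ∑ v ∈ B, (#{x ∈ A | G.Adj x v} : ℝ) := by
    rw [← Nat.cast_sum, ← card_interedges_eq_sum]
    rw [SimpleGraph.edgeDensity_def] at hpd
    push_cast at hpd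
    rw [le_div_iff₀ (by positivity)] at hpd
    linarith
  have hUle : #B * (p * #A) ^ s ≤ ∑ x ∈ Ω, (#(U x) : ℝ) := by
    rw [← Nat.cast_sum, hUsum, Nat.cast_sum]
    push_cast
    rcases s with _ | s
    · simp
    · refine le_trans ?_ (pow_sum_div_card_le_sum_pow (fun v _ => by positivity) s)
      rw [le_div_iff₀ (by positivity)]
      calc (#B : ℝ) * (p * #A) ^ (s + 1) * #B ^ s = (p * #A * #B) ^ (s + 1) := by
            rw [mul_pow (p * #A : ℝ)]; ring
        _ ≤ _ := by gcongr
  have hsum : ∑ x ∈ Ω, ε * (#B : ℝ) ≤ ∑ x ∈ Ω, ((#(U x) : ℝ) - #B * #(badIn x)) := by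
    rw [sum_const, nsmul_eq_mul, hΩcard, sum_sub_distrib, ← mul_sum]
    calc (#A : ℝ) ^ s * (ε * #B) = #B * #A ^ s * ε := by ring
      _ ≤ #B * #A ^ s * (p ^ s - (#B : ℝ) ^ q * ε ^ s) := by gcongr; linarith
      _ = #B * (p * #A) ^ s - #B * ((#B : ℝ) ^ q * (ε * #A) ^ s) := by
          rw [mul_pow, mul_pow]; ring
      _ ≤ _ := by gcongr
  obtain ⟨x, -, hx⟩ := exists_le_of_sum_le hΩ hsum
  have hUB : (#(U x) : ℝ) ≤ #B := by exact_mod_cast card_filter_le _ _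
  have hbad0 : #(badIn x) = 0 := by
    by_contra hne
    have h1 : (1 : ℝ) ≤ #(badIn x) := by exact_mod_cast Nat.one_le_iff_ne_zero.2 hne
    nlinarith [mul_pos hε hB0]
  refine ⟨U x, filter_subset _ _, ?_, fun f hf => ?_⟩
  · simpa [hbad0] using hx
  · by_contra! hlt
    have : f ∈ badIn x := by
      refine mem_filter.2 ⟨mem_filter.2 ⟨?_, hlt⟩, fun i j => (mem_filter.1 (hf j)).2 i⟩
      exact Fintype.mem_piFinset.2 fun j => (mem_filter.1 (hf j)).1
    rw [card_eq_zero.1 hbad0] at this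
    simp at this

lemma Separated.card_le_sub {T₁ T₂ : Finset ℤ} (hT : Separated T₁ T₂) {x y : ℤ} (hx : x ∈ T₁)
    (hy : y ∈ T₂) : (T₁.card : ℤ) ≤ y - x := by
  obtain ⟨h₁, h₂, hsep, -⟩ := hT
  have hsub : T₁ ⊆ Finset.Icc (T₁.min' h₁) (T₁.max' h₁) := fun z hz =>
    Finset.mem_Icc.2 ⟨T₁.min'_le z hz, T₁.le_max' z hz⟩
  have hcard := Finset.card_le_card hsub
  rw [Int.card_Icc] at hcard
  have hx1 := T₁.le_max' x hx
  have hx2 := T₁.min'_le _ (T₁.max'_mem h₁)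
  have hy1 := T₂.min'_le y hy
  omega

lemma mul_dens_le_dens {I T U : Finset ℤ} {x : ℝ} (hTU : x * (T.card : ℝ) ≤ U.card) :
    x * dens I T ≤ dens I U := by
  rw [dens, dens, ← mul_div_assoc]
  gcongr

/-- Splitting step: a dense set in a long interval contains a pair of dense sets at distance of
order `η ^ m * r`, such that every `h` vertices of the second set have a dense common
neighbourhood in the first. -/
lemma Heavy.exists_dense_pair {G : SimpleGraph ℤ} [DecidableRel G.Adj] {a b : ℤ} {S : Finset ℤ}
    {α β γ δ p : ℝ} (hheavy : Heavy G a b S α β γ δ p)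
    (hSne : S.Nonempty) (hSJ : S ⊆ Finset.Icc a b)
    (hα : 0 < α) (hα1 : α < 1) (hβ : 0 < β) (hβ1 : β < 1) (hp : 0 < p)
    {η ε c : ℝ} (hη : 0 < η) (hη1 : η < 1) (hε : 0 < ε) (hε2 : ε ≤ 1 / 2) (hc : c = ε * α / 4)
    {h k r s : ℕ} (hs : (S.card : ℝ) ^ h * ε ^ s ≤ p ^ s - ε)
    (hr : 1 ≤ η ^ k * r) (hηb : η ≤ β * c ^ (2 * h) * dens (Finset.Icc a b) S ^ 2)
    (hδ : δ ≤ c ^ (2 * h))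
    (hγ : γ * S.card ≤ c ^ (2 * h) * β * dens (Finset.Icc a b) S ^ 2 * η ^ k * r)
    {S' : Finset ℤ} (hS' : S' ⊆ S) {a' b' : ℤ} (hS'J : S' ⊆ Finset.Icc a' b')
    {m e : ℕ} (hm : 1 ≤ m) (hmk : m ≤ k) (he : e + 2 ≤ h)
    (hdens : c ^ e * dens (Finset.Icc a b) S ≤ dens (Finset.Icc a' b') S')
    (hlen : η ^ (m - 1) * r ≤ (Finset.Icc a' b').card) :
    ∃ (A U : Finset ℤ) (a₁ b₁ a₂ b₂ : ℤ), A ⊆ S' ∧ U ⊆ S' ∧ U.Nonempty ∧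
      A ⊆ Finset.Icc a₁ b₁ ∧ U ⊆ Finset.Icc a₂ b₂ ∧
      η ^ m * r ≤ (Finset.Icc a₁ b₁).card ∧ η ^ m * r ≤ (Finset.Icc a₂ b₂).card ∧
      (∀ x ∈ A, ∀ y ∈ U, η ^ m * r ≤ ((y - x : ℤ) : ℝ) ∧
        ((y - x : ℤ) : ℝ) < η ^ (m - 1) * r) ∧
      c ^ (e + 1) * dens (Finset.Icc a b) S ≤ dens (Finset.Icc a₂ b₂) U ∧
      ∀ f : Fin h → ℤ, (∀ j, f j ∈ U) →
        ({x ∈ A | ∀ j, G.Adj x (f j)} : Finset ℤ).Nonempty ∧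
        c ^ (e + 1) * dens (Finset.Icc a b) S ≤
          dens (Finset.Icc a₁ b₁) {x ∈ A | ∀ j, G.Adj x (f j)} := by
  set d := dens (Finset.Icc a b) S with hd
  set R := η ^ (m - 1) * r with hR
  have hScard : (0 : ℝ) < S.card := by exact_mod_cast hSne.card_pos
  have hJle : (S.card : ℝ) ≤ (Finset.Icc a b).card := by
    exact_mod_cast Finset.card_le_card hSJ
  have hd0 : 0 < d := div_pos hScard (by linarith)
  have hd1 : d ≤ 1 := div_le_one_of_le₀ hJle (by positivity)
  have hc0 : 0 < c := by rw [hc]; positivity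
  have hcα : c ≤ α / 8 := by rw [hc]; nlinarith
  have hkR : η ^ k * r ≤ R := by
    rw [hR]
    gcongr ?_ * _
    exact pow_le_pow_of_le_one hη.le hη1.le (by omega)
  have hR1 : 1 ≤ R := hr.trans hkR
  have hmR : η ^ m * r = η * R := by
    rw [hR, ← mul_assoc, ← pow_succ']
    congr 2
    omega
  set X := c ^ e with hX
  have hX0 : 0 < X := by positivity
  have hX1 : X ≤ 1 := pow_le_one₀ hc0.le (by linarith)
  set Λ := c ^ (2 * h) with hΛ
  have hΛ0 : 0 < Λ := by positivity
  have hΛX : Λ ≤ α / 8 * X ^ 2 := by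
    calc Λ ≤ c ^ (1 + e * 2) := pow_le_pow_of_le_one hc0.le (by linarith) (by omega)
      _ = c * X ^ 2 := by rw [pow_add, pow_mul, pow_one]
      _ ≤ _ := by gcongr
  have hΛX' : Λ ≤ X / 8 := by nlinarith
  -- pass to a subinterval of length about `R`
  obtain ⟨T, v, hTS', hTv, hTd⟩ := exists_dense_subinterval hS'J (L := ⌊R⌋₊)
    (Nat.floor_pos.2 hR1) (by
      have := (Nat.floor_le (by linarith : 0 ≤ R)).trans hlen
      exact_mod_cast this)
  have hL1 := Nat.floor_le (by linarith : 0 ≤ R)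
  have hL2 : R / 2 ≤ ⌊R⌋₊ := by
    have h1 := Nat.lt_floor_add_one R
    have h2 : (1 : ℝ) ≤ ⌊R⌋₊ := by exact_mod_cast Nat.floor_pos.2 hR1
    linarith
  set L := ⌊R⌋₊
  set ρ := dens (Finset.Icc v (v + L - 1)) T with hρ
  have hρX : X * d / 2 ≤ ρ := by linarith
  have hTcard : (T.card : ℝ) = ρ * L := by
    have h5 : (Finset.Icc v (v + L - 1)).card = L := by rw [Int.card_Icc]; omega
    have h6 : (0 : ℝ) < L := by linarith
    rw [hρ, dens, h5, div_mul_cancel₀ _ h6.ne']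
  have hρ0 : 0 ≤ ρ := le_trans (by positivity) hρX
  have hTge : X * d * R / 4 ≤ T.card := by
    rw [hTcard]
    calc X * d * R / 4 = (X * d / 2) * (R / 2) := by ring
      _ ≤ _ := by gcongr
  have hηR : η * R ≤ β * Λ * d ^ 2 * R := by gcongr
  have hβT : β * Λ * d ^ 2 * R ≤ β * T.card := by
    calc β * Λ * d ^ 2 * R ≤ β * (X / 8) * d * R := by
          gcongr
          exact pow_le_of_le_one hd0.le hd1 two_ne_zero
      _ ≤ β * (X * d * R / 4) := by
          have : 0 ≤ β * (X * d * R) := by positivity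
          linarith
      _ ≤ _ := by gcongr
  obtain ⟨T₁, T₂, a₁, b₁, a₂, b₂, hT₁, hT₂, hI₁, hI₂, hsep, hd₁, hd₂, hl₁, hl₂, hpd⟩ :=
    hheavy T (hTS'.trans hS')
      (by
        calc γ * S.card ≤ Λ * β * d ^ 2 * η ^ k * r := hγ
          _ = β * Λ * d ^ 2 * (η ^ k * r) := by ring
          _ ≤ β * Λ * d ^ 2 * R := by gcongr
          _ ≤ β * T.card := hβT
          _ ≤ T.card := mul_le_of_le_one_left (by positivity) hβ1.le)
      v (v + L - 1) hTv (by
        calc δ * d ≤ X / 8 * d := by gcongr; linarith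
          _ ≤ X * d / 2 := by linarith [mul_pos hX0 hd0]
          _ ≤ ρ := hρX)
  have hT₁ne : T₁.Nonempty := hsep.1
  have hT₂ne : T₂.Nonempty := hsep.2.1
  obtain ⟨U, hUT₂, hUcard, hUf⟩ := dependent_random_choice G hT₁ne hT₂ne hp hε hpd h s (by
    refine le_trans ?_ hs
    gcongr
    exact hT₂.trans (hTS'.trans hS'))
  have hT₁0 : (0 : ℝ) < T₁.card := by exact_mod_cast hT₁ne.card_pos
  have hT₂0 : (0 : ℝ) < T₂.card := by exact_mod_cast hT₂ne.card_pos
  have hstep : c ^ (e + 1) * d ≤ ε * (α * ρ) := by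
    calc c ^ (e + 1) * d = (ε * α / 4) * (X * d) := by rw [pow_succ, ← hX, hc]; ring
      _ ≤ (ε * α) * (X * d / 2) := by
          have : 0 ≤ ε * α * (X * d) := by positivity
          linarith
      _ ≤ (ε * α) * ρ := by gcongr
      _ = _ := by ring
  refine ⟨T₁, U, a₁, b₁, a₂, b₂, hT₁.trans hTS', hUT₂.trans (hT₂.trans hTS'), ?_, hI₁,
    hUT₂.trans hI₂, ?_, ?_, fun x hx y hy => ⟨?_, ?_⟩, ?_, fun f hf => ⟨?_, ?_⟩⟩
  · rw [← Finset.card_pos, ← Nat.cast_pos (α := ℝ)]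
    exact lt_of_lt_of_le (by positivity) hUcard
  · linarith
  · linarith
  · have h1 := hsep.card_le_sub hx (hUT₂ hy)
    have h2 : (T₁.card : ℝ) ≤ ((y - x : ℤ) : ℝ) := by exact_mod_cast h1
    refine le_trans ?_ h2
    have hIpos : (0 : ℝ) < (Finset.Icc a₁ b₁).card := by
      exact_mod_cast Finset.card_pos.2 (hT₁ne.mono hI₁)
    have h3 : α * ρ * (Finset.Icc a₁ b₁).card ≤ T₁.card :=
      (le_div_iff₀ hIpos).1 hd₁
    rw [hmR]
    calc η * R ≤ β * Λ * d ^ 2 * R := hηR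
      _ ≤ β * (α / 8 * X ^ 2) * d ^ 2 * R := by gcongr
      _ = α * (X * d / 2) * (β * (X * d * R / 4)) := by ring
      _ ≤ α * ρ * (β * T.card) := by gcongr
      _ ≤ α * ρ * (Finset.Icc a₁ b₁).card := by
          gcongr
      _ ≤ _ := h3
  · have h1 := Finset.mem_Icc.1 (hTv (hT₁ hx))
    have h2 := Finset.mem_Icc.1 (hTv (hT₂ (hUT₂ hy)))
    have h3 : y - x < (L : ℤ) := by omega
    have h4 : ((y - x : ℤ) : ℝ) < (L : ℝ) := by exact_mod_cast h3
    linarith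
  · calc c ^ (e + 1) * d ≤ ε * (α * ρ) := hstep
      _ ≤ ε * dens (Finset.Icc a₂ b₂) T₂ := by gcongr
      _ ≤ _ := mul_dens_le_dens hUcard
  · rw [← Finset.card_pos, ← Nat.cast_pos (α := ℝ)]
    exact lt_of_lt_of_le (by positivity) (hUf f hf)
  · calc c ^ (e + 1) * d ≤ ε * (α * ρ) := hstep
      _ ≤ ε * dens (Finset.Icc a₁ b₁) T₁ := by gcongr
      _ ≤ _ := mul_dens_le_dens (hUf f hf)

/-- Cliques with prescribed gaps for the index segment `i, …, i + n`, found in any dense subset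
of `S` lying in a long enough interval. -/
lemma Heavy.exists_clique_segment {G : SimpleGraph ℤ} [DecidableRel G.Adj] {a b : ℤ}
    {S : Finset ℤ} {α β γ δ p : ℝ} (hheavy : Heavy G a b S α β γ δ p)
    (hSne : S.Nonempty) (hSJ : S ⊆ Finset.Icc a b)
    (hα : 0 < α) (hα1 : α < 1) (hβ : 0 < β) (hβ1 : β < 1) (hp : 0 < p)
    {η ε c : ℝ} (hη : 0 < η) (hη1 : η < 1) (hε : 0 < ε) (hε2 : ε ≤ 1 / 2) (hc : c = ε * α / 4)
    {h k r s : ℕ} (hs : (S.card : ℝ) ^ h * ε ^ s ≤ p ^ s - ε)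
    (hr : 1 ≤ η ^ k * r) (hηb : η ≤ β * c ^ (2 * h) * dens (Finset.Icc a b) S ^ 2)
    (hδ : δ ≤ c ^ (2 * h))
    (hγ : γ * S.card ≤ c ^ (2 * h) * β * dens (Finset.Icc a b) S ^ 2 * η ^ k * r)
    {φ : ℕ → ℕ} (hφmem : ∀ i, 1 ≤ i → i ≤ h - 1 → 1 ≤ φ i ∧ φ i ≤ k - 1)
    (hφinj : Set.InjOn φ (Set.Icc 1 (h - 1))) (n : ℕ) :
    ∀ i, 1 ≤ i → i + n ≤ h → ∀ S' ⊆ S, S'.Nonempty → ∀ a' b', S' ⊆ Finset.Icc a' b' →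
      c ^ (h - 1 - n) * dens (Finset.Icc a b) S ≤ dens (Finset.Icc a' b') S' →
      (∀ l, i ≤ l → l < i + n → η ^ (φ l - 1) * r ≤ (Finset.Icc a' b').card) →
      ∃ f : ℕ → ℤ, (∀ l, i ≤ l → l ≤ i + n → f l ∈ S') ∧
        (∀ l l', i ≤ l → l < l' → l' ≤ i + n → f l < f l' ∧ G.Adj (f l) (f l')) ∧
        ∀ l, i ≤ l → l < i + n → η ^ φ l * r ≤ ((f (l + 1) - f l : ℤ) : ℝ) ∧
          ((f (l + 1) - f l : ℤ) : ℝ) < η ^ (φ l - 1) * r := by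
  induction n using Nat.strong_induction_on with
  | _ n ih =>
  intro i hi hin S' hS' hS'ne a' b' hS'J hdens hlen
  rcases Nat.eq_zero_or_pos n with rfl | hn
  · obtain ⟨x, hx⟩ := hS'ne
    exact ⟨fun _ => x, fun _ _ _ => hx, fun l l' _ _ _ => by omega, fun l _ _ => by omega⟩
  obtain ⟨l₀, hl₀, hmin⟩ := Finset.exists_min_image (Finset.Ico i (i + n)) φ
    ⟨i, Finset.mem_Ico.2 ⟨le_rfl, by omega⟩⟩
  rw [Finset.mem_Ico] at hl₀
  have hφl₀ := hφmem l₀ (by omega) (by omega)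
  have hlt : ∀ l, i ≤ l → l < i + n → l ≠ l₀ → φ l₀ < φ l := by
    intro l h1 h2 h3
    refine lt_of_le_of_ne (hmin l (Finset.mem_Ico.2 ⟨h1, h2⟩)) fun heq => h3 ?_
    exact hφinj ⟨by omega, by omega⟩ ⟨by omega, by omega⟩ heq.symm
  obtain ⟨A, U, a₁, b₁, a₂, b₂, hAS', hUS', hUne, hAI, hUI, hl₁, hl₂, hgap, hUd, hAf⟩ :=
    hheavy.exists_dense_pair hSne hSJ hα hα1 hβ hβ1 hp hη hη1 hε hε2 hc hs hr hηb hδ hγ hS' hS'J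
      hφl₀.1 (by omega) (by omega) hdens (hlen l₀ hl₀.1 hl₀.2)
  have hc01 : 0 < c ∧ c ≤ 1 := by
    rw [hc]; constructor
    · positivity
    · nlinarith
  have hd0 : 0 ≤ dens (Finset.Icc a b) S := by rw [dens]; positivity
  have hweaken : ∀ n', n' < n → c ^ (h - 1 - n') * dens (Finset.Icc a b) S ≤
      c ^ (h - 1 - n + 1) * dens (Finset.Icc a b) S := by
    intro n' hn'
    gcongr ?_ * _
    exact pow_le_pow_of_le_one hc01.1.le hc01.2 (by omega)
  have hlen' : ∀ l, i ≤ l → l < i + n → l ≠ l₀ → η ^ (φ l - 1) * r ≤ η ^ φ l₀ * r := by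
    intro l h1 h2 h3
    gcongr ?_ * _
    exact pow_le_pow_of_le_one hη.le hη1.le (by have := hlt l h1 h2 h3; omega)
  obtain ⟨g, hgU, hgadj, hggap⟩ := ih (i + n - l₀ - 1) (by omega) (l₀ + 1) (by omega) (by omega)
    U (hUS'.trans hS') hUne a₂ b₂ hUI ((hweaken _ (by omega)).trans hUd)
    (fun l h1 h2 => (hlen' l (by omega) (by omega) (by omega)).trans hl₂)
  have hend : l₀ + 1 + (i + n - l₀ - 1) = i + n := by omega
  rw [hend] at hgU hgadj hggap
  obtain ⟨hWne, hWd⟩ := hAf (fun j => g (min (l₀ + 1 + j) (i + n)))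
    (fun j => hgU _ (by omega) (by omega))
  set W : Finset ℤ := {x ∈ A | ∀ j : Fin h, G.Adj x (g (min (l₀ + 1 + j) (i + n)))} with hW
  have hWA : W ⊆ A := Finset.filter_subset _ _
  have hWadj : ∀ x ∈ W, ∀ l, l₀ + 1 ≤ l → l ≤ i + n → G.Adj x (g l) := by
    intro x hx l h1 h2
    have := (Finset.mem_filter.1 hx).2 ⟨l - (l₀ + 1), by omega⟩
    have hl : min (l₀ + 1 + (l - (l₀ + 1))) (i + n) = l := by omega
    simpa only [hl] using this
  obtain ⟨f, hfW, hfadj, hfgap⟩ := ih (l₀ - i) (by omega) i hi (by omega)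
    W (hWA.trans (hAS'.trans hS')) hWne a₁ b₁ (hWA.trans hAI)
    ((hweaken _ (by omega)).trans hWd)
    (fun l h1 h2 => (hlen' l (by omega) (by omega) (by omega)).trans hl₁)
  have hend' : i + (l₀ - i) = l₀ := by omega
  rw [hend'] at hfW hfadj hfgap
  have hcross : ∀ x ∈ A, ∀ y ∈ U, x < y := by
    intro x hx y hy
    have h1 := (hgap x hx y hy).1
    have h2 : (0 : ℝ) < η ^ φ l₀ * r := by
      have : (0 : ℝ) < r := by
        by_contra! hr0
        nlinarith [pow_pos hη k]
      positivity
    have h3 : (0 : ℝ) < ((y - x : ℤ) : ℝ) := by linarith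
    have : 0 < y - x := by exact_mod_cast h3
    omega
  refine ⟨fun l => if l ≤ l₀ then f l else g l, fun l h1 h2 => ?_, fun l l' h1 h2 h3 => ?_,
    fun l h1 h2 => ?_⟩
  · dsimp only
    split_ifs with h
    · exact hAS' (hWA (hfW l h1 h))
    · exact hUS' (hgU l (by omega) h2)
  · dsimp only
    by_cases h4 : l' ≤ l₀
    · rw [if_pos (by omega), if_pos h4]
      exact hfadj l l' h1 h2 h4
    · rw [if_neg h4]
      split_ifs with h5
      · exact ⟨hcross _ (hWA (hfW l h1 h5)) _ (hgU l' (by omega) h3),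
          hWadj _ (hfW l h1 h5) l' (by omega) h3⟩
      · exact hgadj l l' (by omega) h2 h3
  · dsimp only
    rcases lt_trichotomy l l₀ with h4 | rfl | h4
    · rw [if_pos (by omega), if_pos (by omega)]
      exact hfgap l h1 h4
    · rw [if_neg (by omega), if_pos le_rfl]
      exact hgap _ (hWA (hfW l h1 le_rfl)) _ (hgU (l + 1) le_rfl h2)
    · rw [if_neg (by omega), if_neg (by omega)]
      exact hggap l h4 h2

/-- The exponent `s = ⌊t⌋` meets the numerical requirement of dependent random choice. -/
lemma pow_mul_pow_floor_le {p t ε L : ℝ} (hp : 0 < p) (hp1 : p < 1) {N h k : ℕ} (hhk : h ≤ k)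
    (hN : 0 < N) (hNL : (N : ℝ) = p ^ (-L)) (ht : t ^ 2 = 4 * (k * L)) (ht2 : 2 ≤ t)
    (hε : ε = p ^ t / 2) :
    (N : ℝ) ^ h * ε ^ ⌊t⌋₊ ≤ p ^ ⌊t⌋₊ - ε := by
  have hs1 := Nat.floor_le (by linarith : 0 ≤ t)
  have hs2 := Nat.lt_floor_add_one t
  have hs3 : 1 ≤ ⌊t⌋₊ := Nat.le_floor (by push_cast; linarith)
  set s := ⌊t⌋₊
  have h1 : p ^ t ≤ p ^ s := by
    rw [← Real.rpow_natCast p s]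
    exact Real.rpow_le_rpow_of_exponent_ge hp hp1.le hs1
  have h2 : (N : ℝ) ^ h ≤ p ^ (-(t ^ 2 / 4)) := by
    calc (N : ℝ) ^ h ≤ (N : ℝ) ^ k := pow_le_pow_right₀ (by exact_mod_cast hN) hhk
      _ = p ^ (-(t ^ 2 / 4)) := by
          rw [hNL, ← Real.rpow_natCast, ← Real.rpow_mul hp.le]
          congr 1
          linarith
  have h3 : ε ^ s ≤ p ^ (t * s) / 2 := by
    rw [hε, div_pow, ← Real.rpow_natCast (p ^ t) s, ← Real.rpow_mul hp.le]
    gcongr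
    calc (2 : ℝ) = 2 ^ 1 := by norm_num
      _ ≤ 2 ^ s := pow_le_pow_right₀ (by norm_num) hs3
  have hε0 : 0 < ε := by rw [hε]; positivity
  have h4 : (N : ℝ) ^ h * ε ^ s ≤ p ^ s / 2 := by
    calc (N : ℝ) ^ h * ε ^ s ≤ p ^ (-(t ^ 2 / 4)) * (p ^ (t * s) / 2) := by
          gcongr
      _ = p ^ (-(t ^ 2 / 4) + t * s) / 2 := by rw [Real.rpow_add hp]; ring
      _ ≤ p ^ (s : ℝ) / 2 := by
          gcongr ?_ / _
          refine Real.rpow_le_rpow_of_exponent_ge hp hp1.le ?_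
          nlinarith
      _ = p ^ s / 2 := by rw [Real.rpow_natCast]
  linarith

/-- Lemma 4.4. With `t = 2√(k log_{1/p} |S|)`, `ε = pᵗ/2`,
`λ = (εα/4)^{2h}` and `κ = λ β d_J(S)² η^k r`: if `κ ≥ h`, `|J| ≥ r`,
`η ≤ β λ d_J(S)²`, `δ ≤ λ`, `γ|S| ≤ κ`, and `G` is `(α, β, γ, δ, p)`-heavy with respect
to `S`, then `G` contains a clique of type `(φ, η, r)`. -/
theorem heavy_implies_clique_of_type (G : SimpleGraph ℤ) [DecidableRel G.Adj]
    (V : Finset ℤ) (hGV : ∀ ⦃x y : ℤ⦄, G.Adj x y → x ∈ V)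
    (a b : ℤ) (S : Finset ℤ) (hSne : S.Nonempty)
    (hSJ : S ⊆ Finset.Icc a b) (hSV : S ⊆ V)
    (h k : ℕ) (hh : 1 ≤ h) (hk : 1 ≤ k)
    (φ : ℕ → ℕ)
    (hφmem : ∀ i, 1 ≤ i → i ≤ h - 1 → 1 ≤ φ i ∧ φ i ≤ k - 1)
    (hφinj : Set.InjOn φ (Set.Icc 1 (h - 1)))
    (α β γ δ η p : ℝ)
    (hα : 0 < α) (hα1 : α < 1) (hβ : 0 < β) (hβ1 : β < 1)
    (hγ : 0 < γ) (hγ1 : γ < 1) (hδ : 0 < δ) (hδ1 : δ < 1)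
    (hη : 0 < η) (hη1 : η < 1) (hp : 0 < p) (hp1 : p < 1)
    (r : ℕ) (hr : 0 < r)
    (t ε lam κ : ℝ)
    (ht : t = 2 * Real.sqrt ((k : ℝ) * Real.logb (1 / p) (S.card : ℝ)))
    (hε : ε = p ^ t / 2)
    (hlam : lam = (ε * α / 4) ^ (2 * h))
    (hκ : κ = lam * β * (dens (Finset.Icc a b) S) ^ 2 * η ^ k * (r : ℝ))
    (hκh : (h : ℝ) ≤ κ)
    (hJr : r ≤ (Finset.Icc a b).card)
    (hηbound : η ≤ β * lam * (dens (Finset.Icc a b) S) ^ 2)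
    (hδlam : δ ≤ lam)
    (hγκ : γ * (S.card : ℝ) ≤ κ)
    (hheavy : Heavy G a b S α β γ δ p) :
    CliqueOfType G h φ η r := by
  set d := dens (Finset.Icc a b) S with hd
  set L := Real.logb (1 / p) (S.card : ℝ) with hL
  have hN : (0 : ℝ) < S.card := by exact_mod_cast hSne.card_pos
  have hNle : (S.card : ℝ) ≤ (Finset.Icc a b).card := by
    exact_mod_cast Finset.card_le_card hSJ
  have hd0 : 0 < d := div_pos hN (by linarith)
  have hd1 : d ≤ 1 := div_le_one_of_le₀ hNle (by positivity)
  have hr0 : (0 : ℝ) < r := by exact_mod_cast hr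
  have ht0 : 0 ≤ t := by rw [ht]; positivity
  have hpt0 : 0 < p ^ t := Real.rpow_pos_of_pos hp t
  have hpt1 : p ^ t ≤ 1 := Real.rpow_le_one hp.le hp1.le ht0
  have hε0 : 0 < ε := by rw [hε]; positivity
  have hε2 : ε ≤ 1 / 2 := by rw [hε]; linarith
  have hc0 : 0 < ε * α / 4 := by positivity
  have hc8 : ε * α / 4 ≤ p ^ t / 8 := by rw [hε]; nlinarith
  have hlam0 : 0 < lam := by rw [hlam]; positivity
  have hlamle : lam ≤ (p ^ t / 8) ^ 2 := by
    calc lam ≤ (ε * α / 4) ^ 2 := by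
          rw [hlam]
          exact pow_le_pow_of_le_one hc0.le (by linarith) (by omega)
      _ ≤ _ := by gcongr
  have hlam1 : lam ≤ 1 := hlamle.trans (pow_le_one₀ (by positivity) (by linarith))
  have hκ1 : 1 ≤ κ := le_trans (by exact_mod_cast hh) hκh
  have hηk : 1 ≤ η ^ k * r := by
    refine hκ1.trans ?_
    have : lam * β * d ^ 2 ≤ 1 :=
      mul_le_one₀ (mul_le_one₀ hlam1 hβ.le hβ1.le) (by positivity) (pow_le_one₀ hd0.le hd1)
    calc κ = (lam * β * d ^ 2) * (η ^ k * r) := by rw [hκ]; ring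
      _ ≤ _ := mul_le_of_le_one_left (by positivity) this
  have hNL : (S.card : ℝ) = p ^ (-L) := by
    rw [Real.rpow_neg hp.le, ← Real.inv_rpow hp.le, ← one_div, hL,
      Real.rpow_logb (by positivity) (one_lt_one_div hp hp1).ne' hN]
  have hlamN : 1 ≤ lam * S.card := by
    refine hκ1.trans ?_
    have hdr : d * r ≤ S.card := by
      calc d * r ≤ d * (Finset.Icc a b).card := by gcongr
        _ = S.card := by rw [hd, dens, div_mul_cancel₀ _ (by linarith)]
    calc κ = lam * (β * d * η ^ k) * (d * r) := by rw [hκ]; ring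
      _ ≤ lam * 1 * S.card := by
          gcongr
          exact mul_le_one₀ (mul_le_one₀ hβ1.le hd0.le hd1) (by positivity)
            (pow_le_one₀ hη.le hη1.le)
      _ = _ := by ring
  have hLt : 2 * t < L := by
    have h1 : 1 < p ^ (2 * t - L) := by
      have h2 : p ^ (2 * t - L) = (p ^ t) ^ 2 * S.card := by
        rw [hNL, ← Real.rpow_natCast (p ^ t), ← Real.rpow_mul hp.le, ← Real.rpow_add hp]
        congr 1; push_cast; ring
      rw [h2]
      have h3 : 1 ≤ (p ^ t / 8) ^ 2 * S.card := 
        hlamN.trans (mul_le_mul_of_nonneg_right hlamle hN.le)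
      nlinarith
    by_contra! hle
    exact absurd (Real.rpow_le_one hp.le hp1.le (by linarith : 0 ≤ 2 * t - L)) (by linarith)
  have hL0 : 0 < L := by linarith
  have hk1 : (1 : ℝ) ≤ k := by exact_mod_cast hk
  have htsq : t ^ 2 = 4 * (k * L) := by
    rw [ht, mul_pow, Real.sq_sqrt (by positivity)]; norm_num
  have ht2 : 2 ≤ t := by
    have h1 : 4 * L ≤ t ^ 2 := by rw [htsq]; nlinarith
    have h2 : 0 < t := by
      refine lt_of_le_of_ne ht0 fun h0 => ?_
      rw [← h0] at h1
      linarith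
    have h3 : 8 * t < t * t := by rw [← sq]; linarith
    linarith [lt_of_mul_lt_mul_right h3 ht0]
  have hhk : h ≤ k := by
    have := Finset.card_le_card_of_injOn (s := Finset.Icc 1 (h - 1)) (t := Finset.Icc 1 (k - 1)) φ
      (fun i hi => by
        rw [Finset.mem_coe, Finset.mem_Icc] at hi
        exact Finset.mem_coe.2 (Finset.mem_Icc.2 (hφmem i hi.1 hi.2)))
      (by rw [Finset.coe_Icc]; exact hφinj)
    simp only [Nat.card_Icc] at this
    omega
  have hs := pow_mul_pow_floor_le hp hp1 hhk hSne.card_pos hNL htsq ht2 hε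
  obtain ⟨f, -, hadj, hgap⟩ := hheavy.exists_clique_segment hSne hSJ hα hα1 hβ hβ1 hp hη hη1 hε0
    hε2 rfl hs hηk (hlam ▸ hηbound) (hlam ▸ hδlam) (hlam ▸ hκ ▸ hγκ) hφmem hφinj (h - 1) 1 le_rfl
    (by omega) S subset_rfl hSne a b hSJ (by simp) (fun l _ _ => by
      calc η ^ (φ l - 1) * r ≤ 1 * r := by
            gcongr
            exact pow_le_one₀ hη.le hη1.le
        _ ≤ _ := by rw [one_mul]; exact_mod_cast hJr)
  exact ⟨f, fun i j h1 h2 h3 => hadj i j h1 h2 (by omega),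
    fun i h1 h2 => hgap i h1 (by omega)⟩
end
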